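/- arXiv:0803.0461 — 2 statements merged into one kernel-verified Lean document; each statement's English description precedes it below -/
import Mathlib

section
/- Let (R,𝔪) be a commutative Noetherian local ring, 𝔞 an ideal of R, and M an arbitrary (not necessarily finitely generated) R-module. Define f_𝔞^𝔞(M) := inf{ i ∈ ℕ : 𝔞 is not contained in the radical of Ann_R(H^i_𝔞(M)) } and f_𝔪^𝔞(M) := inf{ i ∈ ℕ : 𝔞 is not contained in the radical of Ann_R(H^i_𝔪(M)) }. If r := f_𝔞^𝔞(M) is finite and r < f_𝔪^𝔞(M), then the local cohomology module H^r_𝔞(M) is not Artinian. -/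
open CategoryTheory Opposite

universe u

lemma CategoryTheory.Iso.inv_comp_eq_comp_inv {C : Type*} [Category* C] {X X' Y Y' : C}
    (α : X ≅ Y) (β : X' ≅ Y') {f : X ⟶ X'} {g : Y ⟶ Y'} (h : α.hom ≫ g = f ≫ β.hom) :
    α.inv ≫ f = g ≫ β.inv := by
  rw [Iso.inv_comp_eq, ← Category.assoc, h, Category.assoc, Iso.hom_inv_id, Category.comp_id]

lemma CategoryTheory.comp_comp_eq_of_squares {C : Type*} [Category* C] {X₁ X₂ X₃ Y₁ Y₂ Y₃ : C}
    {i : X₁ ⟶ X₂} {j : X₂ ⟶ X₃} {i' : Y₁ ⟶ Y₂} {j' : Y₂ ⟶ Y₃} {a : X₁ ⟶ Y₁} {b : X₂ ⟶ Y₂}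
    {c : X₃ ⟶ Y₃} (h₁ : a ≫ i' = i ≫ b) (h₂ : j ≫ c = b ≫ j') :
    a ≫ i' ≫ j' = (i ≫ j) ≫ c := by
  rw [Category.assoc, h₂, reassoc_of% h₁]

namespace CategoryTheory.ProjectiveResolution

open Limits

variable {R : Type u} [CommRing R] {X X' Y : ModuleCat.{u} R}

/-- The map of `Hom` complexes into `Y` induced by a map of resolutions. -/
noncomputable def linearYonedaObjMap {P' : ProjectiveResolution X'} {P : ProjectiveResolution X}
    (φ : P'.complex ⟶ P.complex) (Y : ModuleCat.{u} R) :
    P.complex.linearYonedaObj R Y ⟶ P'.complex.linearYonedaObj R Y :=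
  (HomologicalComplex.unopFunctor _ _).map
    ((((linearYoneda R (ModuleCat.{u} R)).obj Y).rightOp.mapHomologicalComplex _).map φ).op

lemma isoExt_hom_naturality {P' : ProjectiveResolution X'} {P : ProjectiveResolution X} (g : X' ⟶ X)
    (φ : Hom P' P g) (n : ℕ) :
    ((Ext R (ModuleCat.{u} R) n).map g.op).app Y ≫ (P'.isoExt n Y).hom =
      (P.isoExt n Y).hom ≫ HomologicalComplex.homologyMap (linearYonedaObjMap φ.hom Y) n := by
  have h₁ := congrArg Quiver.Hom.unop (ProjectiveResolution.isoLeftDerivedObj_inv_naturality g P' P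
    φ.hom (by simpa using φ.hom_f_zero_comp_π_f_zero)
    ((linearYoneda R (ModuleCat.{u} R)).obj Y).rightOp n)
  have h₂ := congrArg Quiver.Hom.unop
    (HomologicalComplex.homologyOp_hom_naturality (linearYonedaObjMap φ.hom Y) n)
  exact comp_comp_eq_of_squares h₁ (Iso.inv_comp_eq_comp_inv
    (HomologicalComplex.homologyOp (P.complex.linearYonedaObj R Y) n).unop
    (HomologicalComplex.homologyOp (P'.complex.linearYonedaObj R Y) n).unop h₂)

variable (P : ProjectiveResolution X) (n : ℕ) (Y)

lemma extMk_eq_zero_iff_prev (f : P.complex.X n ⟶ Y) (hf : P.complex.d (n + 1) n ≫ f = 0) :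
    P.extMk f (n + 1) rfl hf = 0 ↔
      ∃ g : P.complex.X ((ComplexShape.up ℕ).prev n) ⟶ Y, P.complex.d n _ ≫ g = f := by
  cases n with
  | succ p => 
    rw [P.extMk_eq_zero_iff f (p + 2) rfl hf p rfl, CochainComplex.prev_nat_succ]
  | zero =>
    refine ⟨fun h ↦ ⟨0, ?_⟩, fun ⟨g, hg⟩ ↦ ?_⟩
    · rw [← P.extEquivCohomologyClass.apply_eq_iff_eq, extEquivCohomologyClass_extMk,
        extEquivCohomologyClass_zero, CochainComplex.HomComplex.CohomologyClass.mk_eq_zero_iff,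
        CochainComplex.HomComplex.Cocycle.toSingleMk_mem_coboundaries_iff _ _ _ _ _ 1 (by simp)] at h
      obtain ⟨g, hg⟩ := h
      have h0 : IsZero (P.cochainComplex.X 1) :=
        P.cochainComplex.isZero_of_isStrictlyLE 0 1
      rw [h0.eq_of_src g 0, comp_zero] at hg
      rw [← cancel_epi (P.cochainComplexXIso (-(0 : ℕ)) 0 rfl).hom, ← hg, comp_zero, comp_zero]
    · have : f = 0 := by
        rw [← hg, P.complex.shape _ _ (by simp), zero_comp]
      subst this
      simp

lemma smul_extMk (r : R) (f : P.complex.X n ⟶ Y) (hf : P.complex.d (n + 1) n ≫ f = 0) :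
    P.extMk (r • f) (n + 1) rfl (by simp [hf]) = r • P.extMk f (n + 1) rfl hf := by
  rw [Abelian.Ext.smul_eq_comp_mk₀, extMk_comp_mk₀]
  simp

/-- A cocycle, as a morphism out of a term of the resolution. -/
noncomputable def cyclesHom :
    (P.complex.linearYonedaObj R Y).cycles n →ₗ[R] (P.complex.X n ⟶ Y) :=
  ((P.complex.linearYonedaObj R Y).iCycles n).hom

lemma d_comp_cyclesHom (x : (P.complex.linearYonedaObj R Y).cycles n) :
    P.complex.d (n + 1) n ≫ P.cyclesHom Y n x = 0 :=
  congr($((P.complex.linearYonedaObj R Y).iCycles_d n (n + 1)).hom x)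

lemma cyclesHom_injective : Function.Injective (P.cyclesHom Y n) :=
  (ModuleCat.mono_iff_injective ((P.complex.linearYonedaObj R Y).iCycles n)).mp inferInstance

lemma cyclesHom_toCycles (m : ℕ) (g : P.complex.X m ⟶ Y) :
    P.cyclesHom Y n (((P.complex.linearYonedaObj R Y).toCycles m n).hom g) =
      P.complex.d n m ≫ g :=
  congr($((P.complex.linearYonedaObj R Y).toCycles_i m n).hom g)

/-- The map from cocycles to `Ext`-classes. -/
noncomputable def cyclesToExt :
    (P.complex.linearYonedaObj R Y).cycles n →ₗ[R] Abelian.Ext X Y n where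
  toFun x := P.extMk (P.cyclesHom Y n x) (n + 1) rfl (P.d_comp_cyclesHom Y n x)
  map_add' x y := by
    rw [add_extMk]
    congr 1
    exact map_add _ x y
  map_smul' r x := by
    rw [RingHom.id_apply, ← smul_extMk]
    congr 1
    exact map_smul _ r x

lemma cyclesToExt_surjective : Function.Surjective (P.cyclesToExt Y n) := by
  intro e
  obtain ⟨f, hf, rfl⟩ := P.extMk_surjective e (n + 1) rfl
  have h := ShortComplex.exact_of_f_is_kernel (ShortComplex.mk _ _
    ((P.complex.linearYonedaObj R Y).iCycles_d n (n + 1)))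
    (HomologicalComplex.cyclesIsKernel _ n (n + 1) (by simp))
  obtain ⟨x, hx⟩ := (ShortComplex.moduleCat_exact_iff _).mp h f hf
  refine ⟨x, ?_⟩
  dsimp [cyclesToExt]
  congr 1

lemma ker_cyclesToExt : (P.cyclesToExt Y n).ker =
    ((P.complex.linearYonedaObj R Y).homologyπ n).hom.ker := by
  have h := ShortComplex.exact_of_g_is_cokernel (ShortComplex.mk _ _
    ((P.complex.linearYonedaObj R Y).toCycles_comp_homologyπ _ n))
    (HomologicalComplex.homologyIsCokernel _ _ n rfl)
  have h₂ := (ShortComplex.moduleCat_exact_iff_range_eq_ker _).mp h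
  dsimp at h₂
  rw [← h₂]
  ext x
  rw [LinearMap.mem_ker, LinearMap.mem_range]
  refine (P.extMk_eq_zero_iff_prev Y n _ (P.d_comp_cyclesHom Y n x)).trans (exists_congr fun g ↦ ?_)
  rw [← cyclesHom_toCycles]
  exact (P.cyclesHom_injective Y n).eq_iff

lemma homologyπ_surjective :
    Function.Surjective ((P.complex.linearYonedaObj R Y).homologyπ n).hom :=
  (ModuleCat.epi_iff_surjective _).mp inferInstance

/-- The cohomology of `Hom(P, Y)` is `Ext X Y`. -/
noncomputable def homologyEquivExt :
    (P.complex.linearYonedaObj R Y).homology n ≃ₗ[R] Abelian.Ext X Y n :=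
  (LinearMap.quotKerEquivOfSurjective _ (P.homologyπ_surjective Y n)).symm ≪≫ₗ
    Submodule.quotEquivOfEq _ _ (P.ker_cyclesToExt Y n).symm ≪≫ₗ
    LinearMap.quotKerEquivOfSurjective _ (P.cyclesToExt_surjective Y n)

lemma homologyEquivExt_homologyπ (x : (P.complex.linearYonedaObj R Y).cycles n) :
    P.homologyEquivExt Y n (((P.complex.linearYonedaObj R Y).homologyπ n).hom x) =
      P.cyclesToExt Y n x := by
  have : (LinearMap.quotKerEquivOfSurjective _ (P.homologyπ_surjective Y n)).symm
      (((P.complex.linearYonedaObj R Y).homologyπ n).hom x) = Submodule.Quotient.mk x := by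
    rw [LinearEquiv.symm_apply_eq]
    rfl
  exact congrArg (fun q ↦ LinearMap.quotKerEquivOfSurjective _ (P.cyclesToExt_surjective Y n)
    (Submodule.quotEquivOfEq _ _ (P.ker_cyclesToExt Y n).symm q)) this

/-- Mathlib's two constructions of `Ext` on module categories agree. -/
noncomputable def extLinearEquiv :
    ((Ext R (ModuleCat.{u} R) n).obj (op X)).obj Y ≃ₗ[R] Abelian.Ext X Y n :=
  (P.isoExt n Y).toLinearEquiv ≪≫ₗ P.homologyEquivExt Y n

variable {P Y n} in
lemma extLinearEquiv_map {P' : ProjectiveResolution X'} {g : X' ⟶ X} (φ : Hom P' P g)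
    (x : ((Ext R (ModuleCat.{u} R) n).obj (op X)).obj Y) :
    P'.extLinearEquiv Y n ((((Ext R (ModuleCat.{u} R) n).map g.op).app Y).hom x) =
      (Abelian.Ext.mk₀ g).comp (P.extLinearEquiv Y n x) (zero_add n) := by
  have h := congr($(isoExt_hom_naturality (Y := Y) g φ n).hom x)
  obtain ⟨c, hc⟩ := P.homologyπ_surjective Y n ((P.isoExt n Y).hom.hom x)
  have h₂ : P.extLinearEquiv Y n x = P.cyclesToExt Y n c := by
    rw [← homologyEquivExt_homologyπ, hc]
    rfl
  have h₃ := congr($(HomologicalComplex.homologyπ_naturality (linearYonedaObjMap φ.hom Y) n).hom c)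
  have h₄ : P'.extLinearEquiv Y n ((((Ext R (ModuleCat.{u} R) n).map g.op).app Y).hom x) =
      P'.cyclesToExt Y n ((HomologicalComplex.cyclesMap (linearYonedaObjMap φ.hom Y) n).hom c) := by
    rw [← homologyEquivExt_homologyπ]
    refine congrArg (P'.homologyEquivExt Y n) (h.trans ?_)
    refine Eq.trans ?_ h₃
    simp only [ModuleCat.hom_comp, LinearMap.comp_apply]
    rw [hc]
  rw [h₂, h₄]
  refine Eq.trans ?_ (mk₀_comp_extMk _ (n + 1) rfl (P.d_comp_cyclesHom Y n c) φ).symm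
  dsimp only [cyclesToExt, LinearMap.coe_mk, AddHom.coe_mk]
  congr 1
  exact congr($(HomologicalComplex.cyclesMap_i (linearYonedaObjMap φ.hom Y) n).hom c)

end CategoryTheory.ProjectiveResolution

namespace localCohomology

open Limits

variable {R : Type u} [CommRing R]

section FilteredColimit

variable {J : Type} [SmallCategory J] [IsFiltered J] {F : J ⥤ ModuleCat.{u} R} {c : Cocone F}

instance : PreservesFilteredColimitsOfSize.{0, 0} (forget (ModuleCat.{u} R)) :=
  preservesSmallestFilteredColimits_of_preservesFilteredColimits _

theorem exists_rep_of_isColimit (hc : IsColimit c) (x : c.pt) :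
    ∃ (j : J) (y : F.obj j), (c.ι.app j).hom y = x :=
  Concrete.isColimit_exists_rep _ hc x

theorem ι_app_eq_zero_iff_of_isColimit (hc : IsColimit c) {j : J} (x : F.obj j) :
    (c.ι.app j).hom x = 0 ↔ ∃ (k : J) (f : j ⟶ k), (F.map f).hom x = 0 := by
  have h := Concrete.isColimit_rep_eq_iff_exists F hc x (0 : F.obj j)
  simp only [map_zero] at h
  refine h.trans ⟨fun ⟨k, f, _, hk⟩ ↦ ⟨k, f, hk⟩, fun ⟨k, f, hk⟩ ↦ ⟨k, f, f, hk⟩⟩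

end FilteredColimit

/-- The quotient of a ring by a power of an ideal, as an object of the category of modules. -/
abbrev powQuot (I : Ideal R) (t : ℕ) : ModuleCat.{u} R := ModuleCat.of R (R ⧸ I ^ t)

/-- The projection between quotients by powers of an ideal. -/
noncomputable def powQuotMap (I : Ideal R) {s t : ℕ} (h : t ≤ s) : powQuot I s ⟶ powQuot I t :=
  ModuleCat.ofHom (Submodule.mapQ _ _ LinearMap.id (Ideal.pow_le_pow_right h))

/-- A class in `Ext (R ⧸ I ^ t) M i` whose image in local cohomology vanishes. -/
def EventuallyZero (I : Ideal R) {M : ModuleCat.{u} R} {i t : ℕ}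
    (e : Abelian.Ext (powQuot I t) M i) : Prop :=
  ∃ (s : ℕ) (h : t ≤ s), (Abelian.Ext.mk₀ (powQuotMap I h)).comp e (zero_add i) = 0

theorem exists_toLocalCohomology (I : Ideal R) (i : ℕ) (M : ModuleCat.{u} R) :
    ∃ j : ∀ t, ((Ext R (ModuleCat.{u} R) i).obj (op (powQuot I t))).obj M →ₗ[R]
        (localCohomology I i).obj M,
      (∀ x, ∃ t y, j t y = x) ∧ ∀ t x, j t x = 0 ↔ ∃ (s : ℕ) (h : t ≤ s),
        (((Ext R (ModuleCat.{u} R) i).map (powQuotMap I h).op).app M).hom x = 0 := by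
  have := hasColimitDiagram.{u, 0} (idealPowersDiagram I) i
  let F := diagram (idealPowersDiagram I) i
  let ev := (evaluation (ModuleCat.{u} R) (ModuleCat.{u} R)).obj M
  let c := ev.mapCocone (colimit.cocone F)
  have hc : IsColimit c := isColimitOfPreserves ev (colimit.isColimit F)
  refine ⟨fun t ↦ (c.ι.app (op (op t))).hom, fun x ↦ ?_, fun t x ↦ ?_⟩
  · obtain ⟨k, y, hy⟩ := exists_rep_of_isColimit hc x
    exact ⟨k.unop.unop, y, hy⟩
  · have h := ι_app_eq_zero_iff_of_isColimit hc (j := op (op t)) x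
    refine h.trans ⟨fun ⟨k, f, hk⟩ ↦ ⟨k.unop.unop, f.unop.unop.down.down, hk⟩,
      fun ⟨s, h, hs⟩ ↦ ⟨op (op s), (homOfLE h).op.op, hs⟩⟩

theorem exists_ext_toLocalCohomology (I : Ideal R) (i : ℕ) (M : ModuleCat.{u} R) :
    ∃ ι : ∀ t, Abelian.Ext (powQuot I t) M i →ₗ[R] (localCohomology I i).obj M,
      (∀ x, ∃ t e, ι t e = x) ∧ ∀ t e, ι t e = 0 ↔ EventuallyZero I e := by
  obtain ⟨j, hj, hj₀⟩ := exists_toLocalCohomology I i M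
  let φ (t : ℕ) := (projectiveResolution (powQuot I t)).extLinearEquiv M i
  have hφ (t s : ℕ) (h : t ≤ s) (x) : φ s ((((Ext R (ModuleCat.{u} R) i).map
      (powQuotMap I h).op).app M).hom x) =
      (Abelian.Ext.mk₀ (powQuotMap I h)).comp (φ t x) (zero_add i) :=
    ProjectiveResolution.extLinearEquiv_map ⟨ProjectiveResolution.lift (powQuotMap I h) _ _,
      ProjectiveResolution.lift_commutes_zero _ _ _⟩ x
  refine ⟨fun t ↦ j t ∘ₗ (φ t).symm.toLinearMap, fun x ↦ ?_, fun t e ↦ ?_⟩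
  · obtain ⟨t, y, hy⟩ := hj x
    exact ⟨t, φ t y, (congrArg (j t) ((φ t).symm_apply_apply y)).trans hy⟩
  · obtain ⟨x, rfl⟩ := (φ t).surjective e
    refine (Eq.congr_left (congrArg (j t) ((φ t).symm_apply_apply x))).trans ((hj₀ t x).trans ?_)
    refine exists_congr fun s ↦ exists_congr fun h ↦ ?_
    rw [← hφ, LinearEquiv.map_eq_zero_iff]

end localCohomology

lemma CategoryTheory.Abelian.Ext.comp_assoc_of_first_deg_zero {C : Type*} [Category* C] [Abelian C]
    [HasExt C] {X Y Z T : C} {a₂ a₃ a₂₃ : ℕ} (α : Ext X Y 0) (β : Ext Y Z a₂) (γ : Ext Z T a₃)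
    (h₂₃ : a₂ + a₃ = a₂₃) :
    (α.comp β (zero_add _)).comp γ h₂₃ = α.comp (β.comp γ h₂₃) (zero_add _) := by
  apply comp_assoc
  rwa [zero_add]

namespace localCohomology

variable {R : Type u} [CommRing R]

lemma powQuotMap_comp (I : Ideal R) {s t w : ℕ} (h : t ≤ s) (h' : s ≤ w) :
    powQuotMap I h' ≫ powQuotMap I h = powQuotMap I (h.trans h') := by
  ext
  rfl

lemma smul_id_powQuot (I : Ideal R) {t : ℕ} {z : R} (hz : z ∈ I ^ t) :
    z • 𝟙 (powQuot I t) = 0 := by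
  ext
  exact (Submodule.Quotient.mk_eq_zero (I ^ t)).mpr (Ideal.mul_mem_right _ _ hz)

lemma smul_ext_eq_zero (I : Ideal R) {M : ModuleCat.{u} R} {i t : ℕ} {z : R} (hz : z ∈ I ^ t)
    (e : Abelian.Ext (powQuot I t) M i) : z • e = 0 := by
  rw [← e.mk₀_id_comp, ← Abelian.Ext.smul_comp, ← Abelian.Ext.mk₀_smul, smul_id_powQuot I hz,
    Abelian.Ext.mk₀_zero, Abelian.Ext.zero_comp]

lemma eventuallyZero_zero (I : Ideal R) (M : ModuleCat.{u} R) (i t : ℕ) :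
    EventuallyZero I (0 : Abelian.Ext (powQuot I t) M i) :=
  ⟨t, le_rfl, Abelian.Ext.comp_zero _ _ _ _ _⟩

/-- A fixed power of `y` maps every local cohomology class to a class that is torsion with respect
to each element of `b`. -/
def PowSmulTorsion (y : R) (b : Set R) (I : Ideal R) (i : ℕ) (M : ModuleCat.{u} R) : Prop :=
  ∃ n : ℕ, ∀ (t : ℕ) (e : Abelian.Ext (powQuot I t) M i), ∀ z ∈ b,
    ∃ k : ℕ, EventuallyZero I (z ^ k • y ^ n • e)

variable {y : R} {b : Set R} {I : Ideal R}

lemma powSmulTorsion_of_forall_eq_zero {i : ℕ} {M : ModuleCat.{u} R}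
    (h : ∀ (t : ℕ) (e : Abelian.Ext (powQuot I t) M i), e = 0) : PowSmulTorsion y b I i M :=
  ⟨0, fun t e z _ ↦ ⟨0, by rw [h t (_ • _)]; exact eventuallyZero_zero _ _ _ _⟩⟩

lemma powSmulTorsion_of_smul_eq_zero {i n : ℕ} {M : ModuleCat.{u} R} (h : ∀ x : M, y ^ n • x = 0) :
    PowSmulTorsion y b I i M := by
  refine ⟨n, fun t e z _ ↦ ⟨0, ?_⟩⟩
  have : y ^ n • 𝟙 M = 0 := by
    ext x
    exact h x
  rw [Abelian.Ext.smul_eq_comp_mk₀ e, this, Abelian.Ext.mk₀_zero, Abelian.Ext.comp_zero, smul_zero]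
  exact eventuallyZero_zero _ _ _ _

lemma PowSmulTorsion.of_exact {X Y Z : ModuleCat.{u} R} {i j l p q : ℕ} {u : Abelian.Ext X Y p}
    {v : Abelian.Ext Y Z q} (hu : i + p = j) (hv : j + q = l)
    (h : ∀ (W : ModuleCat.{u} R) (e : Abelian.Ext W Y j), e.comp v hv = 0 →
      ∃ e' : Abelian.Ext W X i, e'.comp u hu = e)
    (hX : PowSmulTorsion y b I i X) (hZ : PowSmulTorsion y b I l Z) : PowSmulTorsion y b I j Y := by
  obtain ⟨m, hm⟩ := hX
  obtain ⟨n, hn⟩ := hZ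
  refine ⟨m + n, fun t e z hz ↦ ?_⟩
  obtain ⟨k, s, hs, h₀⟩ := hn t (e.comp v hv) z hz
  obtain ⟨e', he'⟩ := h (powQuot I s)
    (z ^ k • y ^ n • (Abelian.Ext.mk₀ (powQuotMap I hs)).comp e (zero_add j)) (by
      rw [← h₀, Abelian.Ext.smul_comp, Abelian.Ext.smul_comp, Abelian.Ext.comp_smul,
        Abelian.Ext.comp_smul, Abelian.Ext.comp_assoc_of_first_deg_zero])
  obtain ⟨k', w, hw, h₁⟩ := hm s e' z hz
  refine ⟨k' + k, w, hs.trans hw, ?_⟩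
  have h₂ := congr(($h₁).comp u hu)
  simp only [Abelian.Ext.comp_smul, Abelian.Ext.smul_comp] at h₂ ⊢
  rw [Abelian.Ext.zero_comp, Abelian.Ext.comp_assoc_of_first_deg_zero, he', Abelian.Ext.comp_smul,
    Abelian.Ext.comp_smul, Abelian.Ext.mk₀_comp_mk₀_assoc, powQuotMap_comp] at h₂
  rw [← h₂, pow_add, pow_add, mul_smul, mul_smul, smul_comm (z ^ k) (y ^ m)]

variable {S : ShortComplex (ModuleCat.{u} R)} (hS : S.ShortExact)
include hS

lemma PowSmulTorsion.exact₁ {n : ℕ} (h₃ : PowSmulTorsion y b I n S.X₃)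
    (h₂ : PowSmulTorsion y b I (n + 1) S.X₂) : PowSmulTorsion y b I (n + 1) S.X₁ :=
  .of_exact rfl (add_zero _)
    (fun _ e he ↦ Abelian.Ext.covariant_sequence_exact₁ _ hS e he rfl) h₃ h₂

lemma PowSmulTorsion.exact₂ {n : ℕ} (h₁ : PowSmulTorsion y b I n S.X₁)
    (h₃ : PowSmulTorsion y b I n S.X₃) : PowSmulTorsion y b I n S.X₂ :=
  .of_exact (add_zero _) (add_zero _)
    (fun _ e he ↦ Abelian.Ext.covariant_sequence_exact₂ _ hS e he) h₁ h₃

lemma PowSmulTorsion.exact₃ {n : ℕ} (h₂ : PowSmulTorsion y b I n S.X₂)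
    (h₁ : PowSmulTorsion y b I (n + 1) S.X₁) : PowSmulTorsion y b I n S.X₃ :=
  .of_exact (add_zero _) rfl
    (fun _ e he ↦ Abelian.Ext.covariant_sequence_exact₃ _ hS e rfl he) h₂ h₁

end localCohomology

namespace localCohomology

variable {R : Type u} [CommRing R] {y : R} {b : Set R} {I : Ideal R}

/-- The product of the localizations of a module at the elements of a finite set. -/
abbrev piLocalized (S : Finset R) (M : Type u) [AddCommGroup M] [Module R M] : Type u :=
  ∀ f : S, LocalizedModule (Submonoid.powers (f : R)) M

/-- The projection onto a factor, as an endomorphism of the product. -/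
noncomputable def piLocalizedProj (S : Finset R) (M : Type u) [AddCommGroup M] [Module R M]
    (f : S) : piLocalized S M →ₗ[R] piLocalized S M := by
  classical exact LinearMap.single R _ f ∘ₗ LinearMap.proj f

lemma sum_piLocalizedProj (S : Finset R) (M : Type u) [AddCommGroup M] [Module R M] :
    ∑ f, piLocalizedProj S M f = LinearMap.id := by
  classical
  ext x g
  simp [piLocalizedProj, Finset.sum_apply]

lemma exists_smul_eq_piLocalizedProj (S : Finset R) (M : Type u) [AddCommGroup M] [Module R M]
    (f : S) (t : ℕ) : ∃ q : piLocalized S M →ₗ[R] piLocalized S M,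
      piLocalizedProj S M f = (f : R) ^ t • q := by
  classical
  have h : IsUnit (algebraMap R (Module.End R (LocalizedModule (.powers (f : R)) M)) (f ^ t)) :=
    IsLocalizedModule.map_units (S := .powers (f : R)) (LocalizedModule.mkLinearMap _ M)
      ⟨_, t, rfl⟩
  obtain ⟨v, hv⟩ := h.exists_right_inv
  have hv' (w) : (f : R) ^ t • v w = w := congr($hv w)
  refine ⟨LinearMap.single R _ f ∘ₗ v ∘ₗ LinearMap.proj f, LinearMap.ext fun x ↦ ?_⟩
  refine Eq.trans ?_ (map_smul
    (LinearMap.single R (fun f : S ↦ LocalizedModule (.powers (f : R)) M) f) ((f : R) ^ t) (v (x f)))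
  rw [hv']
  rfl

lemma ext_piLocalized_eq_zero {S : Finset R} (hS : (S : Set R) ⊆ I) (M : Type u) [AddCommGroup M]
    [Module R M] {i t : ℕ} (e : Abelian.Ext (powQuot I t) (ModuleCat.of R (piLocalized S M)) i) :
    e = 0 := by
  have h : ∑ f, ModuleCat.ofHom (piLocalizedProj S M f) = 𝟙 (ModuleCat.of R (piLocalized S M)) := by
    ext1
    rw [ModuleCat.hom_sum]
    exact sum_piLocalizedProj S M
  rw [← e.comp_mk₀_id, ← h, Abelian.Ext.mk₀_sum, Abelian.Ext.comp_sum]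
  refine Finset.sum_eq_zero fun f _ ↦ ?_
  obtain ⟨q, hq⟩ := exists_smul_eq_piLocalizedProj S M f t
  rw [hq, show ModuleCat.ofHom ((f : R) ^ t • q) = (f : R) ^ t • ModuleCat.ofHom q from rfl,
    Abelian.Ext.mk₀_smul, Abelian.Ext.comp_smul]
  exact smul_ext_eq_zero I (Ideal.pow_mem_pow (hS f.2) t) _

/-- The canonical map from a module to the product of its localizations. -/
noncomputable def toPiLocalized (S : Finset R) (M : Type u) [AddCommGroup M] [Module R M] :
    M →ₗ[R] piLocalized S M :=
  LinearMap.pi fun f ↦ LocalizedModule.mkLinearMap (.powers (f : R)) M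

lemma exists_pow_smul_eq_zero_of_mem_ker {S : Finset R} {M : Type u} [AddCommGroup M] [Module R M]
    {x : M} (hx : x ∈ (toPiLocalized S M).ker) :
    ∃ t : ℕ, ∀ z ∈ Ideal.span (S : Set R) ^ t, z • x = 0 := by
  have h : Ideal.span (S : Set R) ≤ (Ideal.torsionOf R M x).radical := by
    rw [Ideal.span_le]
    intro f hf
    have h₁ : LocalizedModule.mkLinearMap (.powers f) M x = 0 := congrFun hx ⟨f, hf⟩
    obtain ⟨⟨_, n, rfl⟩, hc⟩ := (IsLocalizedModule.eq_zero_iff (.powers f) _).mp h₁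
    exact ⟨n, hc⟩
  obtain ⟨t, ht⟩ := Ideal.exists_pow_le_of_le_radical_of_fg h ⟨S, rfl⟩
  exact ⟨t, fun z hz ↦ ht hz⟩

lemma eventuallyZero_mk₀_iff {M : ModuleCat.{u} R} {t : ℕ} (g : powQuot I t ⟶ M) :
    EventuallyZero I (Abelian.Ext.mk₀ g) ↔ g.hom (Submodule.Quotient.mk 1) = 0 := by
  simp only [EventuallyZero, Abelian.Ext.mk₀_comp_mk₀, Abelian.Ext.mk₀_eq_zero_iff]
  refine ⟨fun ⟨s, h, h₀⟩ ↦ congr(($h₀).hom (Submodule.Quotient.mk 1)), fun h ↦ ⟨t, le_rfl, ?_⟩⟩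
  ext
  exact h

lemma exists_pow_smul_eq_zero_of_powSmulTorsion {M : ModuleCat.{u} R}
    (h : PowSmulTorsion y {1} I 0 M) :
    ∃ n : ℕ, ∀ (x : M) (t : ℕ), (∀ z ∈ I ^ t, z • x = 0) → y ^ n • x = 0 := by
  obtain ⟨n, hn⟩ := h
  refine ⟨n, fun x t hx ↦ ?_⟩
  let g : powQuot I t ⟶ M := ModuleCat.ofHom (Submodule.liftQ _ (LinearMap.toSpanSingleton R M x)
    fun z hz ↦ hx z hz)
  obtain ⟨k, hk⟩ := hn t (.mk₀ g) 1 rfl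
  rw [one_pow, one_smul, ← Abelian.Ext.mk₀_smul, eventuallyZero_mk₀_iff] at hk
  have h : y ^ n • (1 : R) • x = 0 := hk
  rwa [one_smul] at h

lemma powSmulTorsion_zero [IsNoetherianRing R] {𝔪 : Ideal R} {M : ModuleCat.{u} R}
    (h₁ : PowSmulTorsion y {1} 𝔪 0 M) (h₂ : PowSmulTorsion y 𝔪 I 0 M) :
    PowSmulTorsion y {1} I 0 M := by
  obtain ⟨n, hn⟩ := exists_pow_smul_eq_zero_of_powSmulTorsion h₁
  obtain ⟨m, hm⟩ := h₂
  refine ⟨n + m, fun t e z _ ↦ ⟨0, ?_⟩⟩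
  obtain ⟨g, rfl⟩ := (Abelian.Ext.mk₀_bijective _ _).2 e
  have h (z : R) (hz : z ∈ 𝔪) : ∃ k : ℕ, z ^ k • y ^ m • g.hom (Submodule.Quotient.mk 1) = 0 := by
    obtain ⟨k, hk⟩ := hm t (.mk₀ g) z hz
    rw [← Abelian.Ext.mk₀_smul, ← Abelian.Ext.mk₀_smul, eventuallyZero_mk₀_iff] at hk
    exact ⟨k, hk⟩
  obtain ⟨k, hk⟩ := Ideal.exists_pow_le_of_le_radical_of_fg
    (J := Ideal.torsionOf R M (y ^ m • g.hom (Submodule.Quotient.mk 1))) h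
    (IsNoetherian.noetherian 𝔪)
  rw [pow_zero, one_smul, ← Abelian.Ext.mk₀_smul, eventuallyZero_mk₀_iff, pow_add, mul_smul]
  exact hn _ k fun z hz ↦ hk hz

lemma shortExact_ker_range {A B : Type u} [AddCommGroup A] [AddCommGroup B] [Module R A]
    [Module R B] (f : A →ₗ[R] B) :
    (ShortComplex.mk (ModuleCat.ofHom f.ker.subtype) (ModuleCat.ofHom f.rangeRestrict)
      (ModuleCat.hom_ext (LinearMap.ext fun x ↦ Subtype.ext x.2))).ShortExact where
  exact := (ShortComplex.moduleCat_exact_iff _).mpr fun x hx ↦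
    ⟨⟨x, congrArg Subtype.val hx⟩, rfl⟩
  mono_f := (ModuleCat.mono_iff_injective _).mpr f.ker.injective_subtype
  epi_g := (ModuleCat.epi_iff_surjective _).mpr f.surjective_rangeRestrict

lemma shortExact_subtype_mkQ {A : Type u} [AddCommGroup A] [Module R A] (N : Submodule R A) :
    (ShortComplex.mk (ModuleCat.ofHom N.subtype) (ModuleCat.ofHom N.mkQ)
      (by ext x; exact (Submodule.Quotient.mk_eq_zero N).mpr x.2)).ShortExact where
  exact := (ShortComplex.moduleCat_exact_iff _).mpr fun x hx ↦
    ⟨⟨x, (Submodule.Quotient.mk_eq_zero N).mp hx⟩, rfl⟩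
  mono_f := (ModuleCat.mono_iff_injective _).mpr N.injective_subtype
  epi_g := (ModuleCat.epi_iff_surjective _).mpr N.mkQ_surjective

theorem powSmulTorsion_of_powSmulTorsion_maximal [IsNoetherianRing R] {𝔞 𝔪 : Ideal R} (h𝔞 : 𝔞 ≤ 𝔪)
    (r : ℕ) (M : ModuleCat.{u} R) (h₁ : ∀ i < r, PowSmulTorsion y {1} 𝔞 i M)
    (h₂ : ∀ i ≤ r, PowSmulTorsion y {1} 𝔪 i M) (h₃ : PowSmulTorsion y 𝔪 𝔞 r M) :
    PowSmulTorsion y {1} 𝔞 r M := by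
  induction r generalizing M with
  | zero => exact powSmulTorsion_zero (h₂ 0 le_rfl) h₃
  | succ r ih =>
    obtain ⟨S, hS⟩ := IsNoetherian.noetherian 𝔞
    obtain ⟨n, hn⟩ := exists_pow_smul_eq_zero_of_powSmulTorsion (h₁ 0 r.succ_pos)
    let φ := toPiLocalized S M
    have hK (x : φ.ker) : y ^ n • x = 0 := by
      obtain ⟨t, ht⟩ := exists_pow_smul_eq_zero_of_mem_ker x.2
      refine Subtype.ext (hn x t fun z hz ↦ ht z ?_)
      rwa [← hS] at hz
    have hKtors (b I i) : PowSmulTorsion y b I i (ModuleCat.of R φ.ker) :=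
      powSmulTorsion_of_smul_eq_zero hK
    have hF {I : Ideal R} (hI : 𝔞 ≤ I) (b i) :
        PowSmulTorsion y b I i (ModuleCat.of R (piLocalized S M)) :=
      powSmulTorsion_of_forall_eq_zero fun t e ↦
        ext_piLocalized_eq_zero (Ideal.span_le.mp (hS.trans_le hI)) M e
    have hM := shortExact_ker_range φ
    have hN := shortExact_subtype_mkQ φ.range
    have hQ {I : Ideal R} (hI : 𝔞 ≤ I) {b i} (h : PowSmulTorsion y b I (i + 1) M) :
        PowSmulTorsion y b I i (ModuleCat.of R (piLocalized S M ⧸ φ.range)) :=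
      PowSmulTorsion.exact₃ hN (hF hI _ _) (PowSmulTorsion.exact₃ hM h (hKtors _ _ _))
    have h := ih (ModuleCat.of R (piLocalized S M ⧸ φ.range))
      (fun i hi ↦ hQ le_rfl (h₁ (i + 1) (by lia))) (fun i hi ↦ hQ h𝔞 (h₂ (i + 1) (by lia)))
      (hQ le_rfl h₃)
    exact PowSmulTorsion.exact₂ hM (hKtors _ _ _) (PowSmulTorsion.exact₁ hN h (hF le_rfl _ _))

theorem powSmulTorsion_one_iff {i : ℕ} {M : ModuleCat.{u} R} :
    PowSmulTorsion y {1} I i M ↔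
      y ∈ (Module.annihilator R ((localCohomology I i).obj M)).radical := by
  obtain ⟨ι, hι, hι₀⟩ := exists_ext_toLocalCohomology I i M
  refine exists_congr fun n ↦ ?_
  rw [Module.mem_annihilator]
  refine ⟨fun h x ↦ ?_, fun h t e z hz ↦ ⟨0, ?_⟩⟩
  · obtain ⟨t, e, rfl⟩ := hι x
    obtain ⟨k, hk⟩ := h t e 1 rfl
    rw [one_pow, one_smul, ← hι₀, map_smul] at hk
    exact hk
  · rw [pow_zero, one_smul, ← hι₀, map_smul, h]

theorem powSmulTorsion_of_isTorsion {𝔪 : Ideal R} {i : ℕ} {M : ModuleCat.{u} R}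
    (h : ∀ x : (localCohomology I i).obj M, ∃ k : ℕ, ∀ z ∈ 𝔪 ^ k, z • x = 0) :
    PowSmulTorsion y 𝔪 I i M := by
  obtain ⟨ι, hι, hι₀⟩ := exists_ext_toLocalCohomology I i M
  refine ⟨0, fun t e z hz ↦ ?_⟩
  obtain ⟨k, hk⟩ := h (ι t e)
  refine ⟨k, ?_⟩
  rw [← hι₀, pow_zero, one_smul, map_smul, hk _ (Ideal.pow_mem_pow hz k)]

end localCohomology

lemma IsArtinian.exists_pow_smul_eq_zero {R : Type*} [CommRing R] [IsNoetherianRing R]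
    [IsLocalRing R] {H : Type*} [AddCommGroup H] [Module R H] [IsArtinian R H] (x : H) :
    ∃ k : ℕ, ∀ z ∈ IsLocalRing.maximalIdeal R ^ k, z • x = 0 := by
  let 𝔪 := IsLocalRing.maximalIdeal R
  obtain ⟨k, hk⟩ := IsArtinian.monotone_stabilizes (R := R) (M := H)
    ⟨fun k ↦ OrderDual.toDual (𝔪 ^ k • (R ∙ x)), fun i j hij ↦
      Submodule.smul_mono_left (Ideal.pow_le_pow_right hij)⟩
  refine ⟨k, fun z hz ↦ ?_⟩
  have h : 𝔪 ^ k • (R ∙ x) = ⊥ := by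
    refine Submodule.eq_bot_of_le_smul_of_le_jacobson_bot 𝔪 _ ?_ ?_
      (IsLocalRing.maximalIdeal_le_jacobson _)
    · exact Submodule.FG.smul (IsNoetherian.noetherian _) (Submodule.fg_span_singleton x)
    · rw [← mul_smul, ← pow_succ']
      exact (congrArg OrderDual.ofDual (hk (k + 1) (Nat.le_succ k))).le
  rw [← Submodule.mem_bot R, ← h]
  exact Submodule.smul_mem_smul hz (Submodule.mem_span_singleton_self x)

theorem finiteness_dim_lt_m_finiteness_dim_not_artinian
    {R : Type u} [CommRing R] [IsNoetherianRing R] [IsLocalRing R]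
    (𝔞 : Ideal R) (M : Type u) [AddCommGroup M] [Module R M] (r : ℕ)
    (h_mem : ¬ 𝔞 ≤ (Module.annihilator R ((localCohomology 𝔞 r).obj (ModuleCat.of R M))).radical)
    (h_min : ∀ i < r,
      𝔞 ≤ (Module.annihilator R ((localCohomology 𝔞 i).obj (ModuleCat.of R M))).radical)
    (h_lt : ∀ i ≤ r,
      𝔞 ≤ (Module.annihilator R
        ((localCohomology (IsLocalRing.maximalIdeal R) i).obj (ModuleCat.of R M))).radical) :
    ¬ IsArtinian R ((localCohomology 𝔞 r).obj (ModuleCat.of R M)) := by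
  intro hArt
  refine h_mem fun y hy ↦ localCohomology.powSmulTorsion_one_iff.mp ?_
  by_cases h𝔞 : 𝔞 = ⊤
  · refine localCohomology.powSmulTorsion_of_forall_eq_zero fun t e ↦ ?_
    rw [← one_smul R e]
    exact localCohomology.smul_ext_eq_zero 𝔞 (by simp [h𝔞, Ideal.top_pow]) e
  · exact localCohomology.powSmulTorsion_of_powSmulTorsion_maximal
      (IsLocalRing.le_maximalIdeal h𝔞) r _
      (fun i hi ↦ localCohomology.powSmulTorsion_one_iff.mpr (h_min i hi hy))
      (fun i hi ↦ localCohomology.powSmulTorsion_one_iff.mpr (h_lt i hi hy))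
      (localCohomology.powSmulTorsion_of_isTorsion IsArtinian.exists_pow_smul_eq_zero)
end

section
/- Let (R,𝔪) be a commutative Noetherian local ring, 𝔞 an ideal of R, and M a finitely generated R-module. Define f_𝔪^𝔞(M) := inf{ i ∈ ℕ : 𝔞 is not contained in the radical of Ann_R(H^i_𝔪(M)) }. If the finiteness dimension f_𝔞(M) is finite and f_𝔞(M) < f_𝔪^𝔞(M), then inf{ i ∈ ℕ : H^i_𝔞(M) is not Artinian } ≤ f_𝔞(M); in particular there exists i ≤ f_𝔞(M) such that H^i_𝔞(M) is not Artinian. -/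
/-!
STATEMENT 1: Let (R,𝔪) be a commutative Noetherian local ring, 𝔞 an ideal of R, and M a
finitely generated R-module. If the finiteness dimension f_𝔞(M) is finite and
f_𝔞(M) < f_𝔪^𝔞(M), then inf{ i : H^i_𝔞(M) is not Artinian } ≤ f_𝔞(M); in particular there
exists i ≤ f_𝔞(M) with H^i_𝔞(M) not Artinian.

We encode `r = f_𝔞(M)` by: `H^i_𝔞(M)` is finitely generated for all `i < r` and `H^r_𝔞(M)` is
not; and `r < f_𝔪^𝔞(M)` by: `𝔞 ≤ rad(Ann H^i_𝔪(M))` for all `i ≤ r`.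
-/

open CategoryTheory Opposite

universe u

open CategoryTheory.Abelian

section Torsion

variable {R : Type u} [CommRing R] (𝔞 : Ideal R) (M : Type u) [AddCommGroup M] [Module R M]

/-- The `𝔞`-torsion submodule: the elements killed by a power of each element of `𝔞`. -/
def idealTorsion : Submodule R M where
  carrier := {v | ∀ a ∈ 𝔞, ∃ k : ℕ, a ^ k • v = 0}
  zero_mem' := fun _ _ ↦ ⟨0, smul_zero _⟩
  add_mem' := by
    intro v w hv hw a ha
    obtain ⟨k, hk⟩ := hv a ha
    obtain ⟨l, hl⟩ := hw a ha
    refine ⟨k + l, ?_⟩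
    rw [smul_add, pow_add, mul_smul, mul_smul, hl, smul_comm, hk, smul_zero, smul_zero, add_zero]
  smul_mem' := by
    intro c v hv a ha
    obtain ⟨k, hk⟩ := hv a ha
    exact ⟨k, by rw [smul_comm, hk, smul_zero]⟩

theorem idealTorsion_quotient_eq_bot :
    idealTorsion 𝔞 (M ⧸ idealTorsion 𝔞 M) = ⊥ := by
  rw [eq_bot_iff]
  intro v hv
  obtain ⟨v, rfl⟩ := Submodule.Quotient.mk_surjective _ v
  rw [Submodule.mem_bot, Submodule.Quotient.mk_eq_zero]
  intro a ha
  obtain ⟨k, hk⟩ := hv a ha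
  rw [← Submodule.Quotient.mk_smul, Submodule.Quotient.mk_eq_zero] at hk
  obtain ⟨l, hl⟩ := hk a ha
  exact ⟨l + k, by rw [pow_add, mul_smul, hl]⟩

variable {M} in
theorem le_radical_annihilator_of_forall_exists [Module.Finite R M]
    (h : ∀ a ∈ 𝔞, ∀ v : M, ∃ k : ℕ, a ^ k • v = 0) :
    𝔞 ≤ (Module.annihilator R M).radical := by
  intro a ha
  obtain ⟨s, hs⟩ := Module.Finite.fg_top (R := R) (M := M)
  choose k hk using h a ha
  refine ⟨s.sup k, Module.mem_annihilator.2 fun v ↦ ?_⟩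
  have hv : v ∈ Submodule.span R (s : Set M) := hs ▸ Submodule.mem_top
  induction hv using Submodule.span_induction with
  | mem x hx =>
    rw [← Nat.sub_add_cancel (Finset.le_sup (f := k) hx), pow_add, mul_smul, hk, smul_zero]
  | zero => exact smul_zero _
  | add x y _ _ hx hy => rw [smul_add, hx, hy, add_zero]
  | smul c x _ hx => rw [smul_comm, hx, smul_zero]

variable {M} in
theorem exists_isSMulRegular_of_idealTorsion_eq_bot [IsNoetherianRing R] [Module.Finite R M]
    (h : idealTorsion 𝔞 M = ⊥) : ∃ x ∈ 𝔞, IsSMulRegular M x := by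
  have : Subsingleton ((R ⧸ 𝔞) →ₗ[R] M) := by
    refine ⟨fun f g ↦ LinearMap.ext fun q ↦ ?_⟩
    have key (f : (R ⧸ 𝔞) →ₗ[R] M) : f q = 0 := by
      rw [← Submodule.mem_bot R, ← h]
      intro a ha
      refine ⟨1, ?_⟩
      obtain ⟨q, rfl⟩ := Ideal.Quotient.mk_surjective q
      rw [pow_one, ← map_smul, ← Ideal.Quotient.mk_eq_mk, ← Submodule.Quotient.mk_smul,
        (Submodule.Quotient.mk_eq_zero _).2 (by simpa using 𝔞.mul_mem_right q ha), map_zero]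
    rw [key, key]
  simpa [Ideal.annihilator_quotient] using IsSMulRegular.subsingleton_linearMap_iff.1 this

end Torsion

section

variable {R : Type u} [CommRing R]

/-- Restriction of `Ext` classes along the projection `R ⧸ I → R ⧸ J`. -/
noncomputable def extQuotRes {I J : Ideal R} (h : I ≤ J) (M : ModuleCat.{u} R) (i : ℕ) :
    Ext (ModuleCat.of R (R ⧸ J)) M i →ₗ[R] Ext (ModuleCat.of R (R ⧸ I)) M i :=
  (Ext.mk₀ (ModuleCat.ofHom (Submodule.factor h))).precompOfLinear R M (zero_add i)

theorem extQuotRes_apply {I J : Ideal R} (h : I ≤ J) (M : ModuleCat.{u} R) (i : ℕ)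
    (e : Ext (ModuleCat.of R (R ⧸ J)) M i) :
    extQuotRes h M i e =
      (Ext.mk₀ (ModuleCat.ofHom (Submodule.factor h))).comp e (zero_add i) := rfl

@[simp]
theorem extQuotRes_extQuotRes {I J K : Ideal R} (h : I ≤ J) (h' : J ≤ K) (M : ModuleCat.{u} R)
    (i : ℕ) (e : Ext (ModuleCat.of R (R ⧸ K)) M i) :
    extQuotRes h M i (extQuotRes h' M i e) = extQuotRes (h.trans h') M i e := by
  rw [extQuotRes_apply, extQuotRes_apply, Ext.mk₀_comp_mk₀_assoc, ← ModuleCat.ofHom_comp,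
    Submodule.factor_comp, extQuotRes_apply]

theorem extQuotRes_comp {I J : Ideal R} (h : I ≤ J) {M N : ModuleCat.{u} R} {i j k : ℕ}
    (e : Ext (ModuleCat.of R (R ⧸ J)) M i) (f : Ext M N j) (hk : i + j = k) :
    extQuotRes h N k (e.comp f hk) = (extQuotRes h M i e).comp f hk := by
  rw [extQuotRes_apply, extQuotRes_apply, Ext.comp_assoc _ _ _ _ _ (by lia)]

/-- The `Ext⁰` class of the map `R ⧸ I → M` sending `1` to an element killed by `I`. -/
noncomputable def extZeroMk {I : Ideal R} {M : ModuleCat.{u} R} (v : M)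
    (hv : ∀ a ∈ I, a • v = 0) : Ext (ModuleCat.of R (R ⧸ I)) M 0 :=
  Ext.mk₀ (ModuleCat.ofHom (Submodule.liftQ I (LinearMap.toSpanSingleton R M v) hv))

theorem exists_extZeroMk {I : Ideal R} {M : ModuleCat.{u} R}
    (e : Ext (ModuleCat.of R (R ⧸ I)) M 0) :
    ∃ (v : M) (hv : ∀ a ∈ I, a • v = 0), extZeroMk v hv = e := by
  obtain ⟨f, rfl⟩ := (Ext.mk₀_bijective _ _).2 e
  refine ⟨f.hom (Submodule.Quotient.mk 1), fun a ha ↦ ?_, ?_⟩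
  · rw [← map_smul, ← Submodule.Quotient.mk_smul, (Submodule.Quotient.mk_eq_zero I).2 (by simpa),
      map_zero]
  · unfold extZeroMk
    congr 1
    ext
    simp

theorem extQuotRes_extZeroMk {I J : Ideal R} (h : I ≤ J) {M : ModuleCat.{u} R} (v : M)
    (hv : ∀ a ∈ J, a • v = 0) :
    extQuotRes h M 0 (extZeroMk v hv) = extZeroMk v fun a ha ↦ hv a (h ha) := by
  rw [extQuotRes_apply, extZeroMk, Ext.mk₀_comp_mk₀, extZeroMk]
  congr 1
  ext
  rfl

theorem smul_extZeroMk {I : Ideal R} {M : ModuleCat.{u} R} (v : M)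
    (hv : ∀ a ∈ I, a • v = 0) (c : R) :
    c • extZeroMk v hv = extZeroMk (c • v) fun a ha ↦ by rw [smul_comm, hv a ha, smul_zero] := by
  rw [extZeroMk, ← Ext.mk₀_smul, extZeroMk]
  congr 1
  ext
  exact smul_comm c (1 : R) v

theorem eq_zero_of_extZeroMk_eq_zero {I : Ideal R} {M : ModuleCat.{u} R} (v : M)
    (hv : ∀ a ∈ I, a • v = 0) (h : extZeroMk v hv = 0) : v = 0 := by
  rw [extZeroMk, Ext.mk₀_eq_zero_iff] at h
  rw [← one_smul R v]
  exact congr($(h).hom (Submodule.Quotient.mk 1))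

theorem smul_ext_eq_zero_of_mem {I : Ideal R} {M : ModuleCat.{u} R} {i : ℕ}
    (e : Ext (ModuleCat.of R (R ⧸ I)) M i) {y : R} (hy : y ∈ I) : y • e = 0 := by
  have h : y • 𝟙 (ModuleCat.of R (R ⧸ I)) = 0 := by
    ext
    exact (Submodule.Quotient.mk_eq_zero I).2 (by simpa using hy)
  rw [← Ext.mk₀_id_comp e, ← Ext.smul_comp, ← Ext.mk₀_smul, h, Ext.mk₀_zero, Ext.zero_comp]

end

section Vanishing

variable {R : Type u} [CommRing R]

/-- In a morphism of presentations whose map on kernels lands in a submodule on which all classes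
of degree `i` vanish, restriction along the map of presented modules kills degree `i + 1`. -/
theorem mk₀_comp_eq_zero_of_presentation {F N F' N' : Type u} [AddCommGroup F] [Module R F]
    [AddCommGroup N] [Module R N] [AddCommGroup F'] [Module R F'] [AddCommGroup N'] [Module R N']
    [Projective (ModuleCat.of R F)] {T : ModuleCat.{u} R} {i : ℕ}
    {π : F →ₗ[R] N} (hπ : Function.Surjective π) {π' : F' →ₗ[R] N'} (hπ' : Function.Surjective π')
    (g : F' →ₗ[R] F) (h : N' →ₗ[R] N) (comm : h ∘ₗ π' = π ∘ₗ g) (P : Submodule R π.ker)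
    (hP : ∀ x : F', π' x = 0 → ∀ hx : g x ∈ π.ker, (⟨g x, hx⟩ : π.ker) ∈ P)
    (hc : ∀ c : Ext (ModuleCat.of R π.ker) T i,
      (Ext.mk₀ (ModuleCat.ofHom P.subtype)).comp c (zero_add i) = 0)
    (e : Ext (ModuleCat.of R N) T (i + 1)) :
    (Ext.mk₀ (ModuleCat.ofHom h)).comp e (zero_add (i + 1)) = 0 := by
  have hS := LinearMap.shortExact_shortComplexKer hπ
  have hS' := LinearMap.shortExact_shortComplexKer hπ'
  have hker (x : π'.ker) : g x ∈ π.ker := by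
    rw [LinearMap.mem_ker, ← LinearMap.comp_apply, ← comm, LinearMap.comp_apply, x.2, map_zero]
  let β : π'.ker →ₗ[R] P :=
    LinearMap.codRestrict _ (LinearMap.codRestrict _ (g ∘ₗ Submodule.subtype _) hker)
      fun x ↦ hP x x.2 (hker x)
  let φ : π'.shortComplexKer ⟶ π.shortComplexKer :=
    { τ₁ := ModuleCat.ofHom (P.subtype ∘ₗ β)
      τ₂ := ModuleCat.ofHom g
      τ₃ := ModuleCat.ofHom h
      comm₂₃ := ModuleCat.hom_ext comm.symm }
  obtain ⟨c, rfl⟩ := precomp_extClass_surjective_of_projective_X₂ T hS i e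
  have h1 := ShortComplex.ShortExact.extClass_naturality hS' hS φ
  have h2 : (Ext.mk₀ φ.τ₁).comp c (zero_add i) = 0 := by
    have : φ.τ₁ = ModuleCat.ofHom β ≫ ModuleCat.ofHom P.subtype := rfl
    rw [this, ← Ext.mk₀_comp_mk₀_assoc, hc c, Ext.comp_zero]
  change (Ext.mk₀ φ.τ₃).comp (hS.extClass.comp c (add_comm 1 i)) _ = 0
  rw [← Ext.comp_assoc (a₁₂ := 1) _ _ _ (by lia) (by lia) (by lia), ← h1,
    Ext.comp_assoc_of_second_deg_zero, h2, Ext.comp_zero]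

variable [IsNoetherianRing R]

/-- Classes of `Ext` into a module killed by a power of `J` vanish on `J ^ s N` for large `s`. -/
theorem exists_forall_ext_restrict_pow_smul_eq_zero (J : Ideal R) (T : ModuleCat.{u} R)
    (hT : J ≤ (Module.annihilator R T).radical) (i : ℕ) (N : Type u) [AddCommGroup N] [Module R N]
    [Module.Finite R N] :
    ∃ s : ℕ, ∀ e : Ext (ModuleCat.of R N) T i,
      (Ext.mk₀ (ModuleCat.ofHom (J ^ s • (⊤ : Submodule R N)).subtype)).comp e
        (zero_add i) = 0 := by
  induction i generalizing N with
  | zero =>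
    obtain ⟨s, hs⟩ := Ideal.exists_pow_le_of_le_radical_of_fg hT (IsNoetherian.noetherian J)
    refine ⟨s, fun e ↦ ?_⟩
    obtain ⟨f, rfl⟩ := (Ext.mk₀_bijective _ _).2 e
    rw [Ext.mk₀_comp_mk₀, Ext.mk₀_eq_zero_iff]
    ext ⟨x, hx⟩
    change f.hom x = 0
    induction hx using Submodule.smul_induction_on' with
    | smul r hr n _ => rw [map_smul, Module.mem_annihilator.1 (hs hr)]
    | add x _ y _ hx hy => rw [map_add, hx, hy, add_zero]
  | succ i ih =>
    obtain ⟨F, _, _, _, _, π, hπ⟩ := Module.exists_finite_presentation R N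
    obtain ⟨s, hs⟩ := ih π.ker
    obtain ⟨k, hk⟩ := J.exists_pow_inf_eq_pow_smul π.ker
    have hle : π.ker ⊓ J ^ (s + k) • (⊤ : Submodule R F) ≤ J ^ s • π.ker := by
      rw [inf_comm, hk (s + k) (by lia), Nat.add_sub_cancel]
      exact Submodule.smul_mono le_rfl inf_le_right
    have hmap (x : F) (hx : x ∈ J ^ (s + k) • (⊤ : Submodule R F)) :
        π x ∈ J ^ (s + k) • (⊤ : Submodule R N) := by
      have := Submodule.mem_map_of_mem (f := π) hx
      rw [Submodule.map_smul''] at this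
      exact Submodule.smul_mono le_rfl le_top this
    let π' : (J ^ (s + k) • (⊤ : Submodule R F) : Submodule R F) →ₗ[R]
        (J ^ (s + k) • (⊤ : Submodule R N) : Submodule R N) := π.restrict hmap
    have hπ' : Function.Surjective π' := by
      rintro ⟨y, hy⟩
      rw [← LinearMap.range_eq_top.2 hπ, LinearMap.range_eq_map, ← Submodule.map_smul''] at hy
      obtain ⟨x, hx, rfl⟩ := hy
      exact ⟨⟨x, hx⟩, rfl⟩
    refine ⟨s + k, mk₀_comp_eq_zero_of_presentation hπ hπ' (Submodule.subtype _)
      (Submodule.subtype _) rfl _ (fun x _ hx ↦ ?_) hs⟩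
    have hx' : (x : F) ∈ J ^ s • π.ker := hle ⟨hx, x.2⟩
    rw [← π.ker.range_subtype, LinearMap.range_eq_map, ← Submodule.map_smul''] at hx'
    obtain ⟨y, hy, hyx⟩ := hx'
    exact (Subtype.ext hyx : y = ⟨_, hx⟩) ▸ hy

theorem exists_forall_extQuotRes_eq_zero {J : Ideal R} {T : ModuleCat.{u} R}
    (hT : J ≤ (Module.annihilator R T).radical) (i : ℕ) {I : Ideal R} (hI : J ≤ I.radical) :
    ∃ (K : Ideal R) (h : K ≤ I), J ≤ K.radical ∧ ∀ e, extQuotRes h T (i + 1) e = 0 := by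
  obtain ⟨s, hs⟩ := exists_forall_ext_restrict_pow_smul_eq_zero J T hT i (LinearMap.ker I.mkQ)
  refine ⟨J ^ s * I, Ideal.mul_le_right, ?_, ?_⟩
  · rw [Ideal.radical_mul]
    refine le_inf (fun x hx ↦ ⟨s, Ideal.pow_mem_pow hx s⟩) hI
  · refine mk₀_comp_eq_zero_of_presentation I.mkQ_surjective (Submodule.mkQ_surjective _)
      LinearMap.id _ rfl _ (fun x hx hx' ↦ ?_) hs
    have hx1 : x ∈ J ^ s • LinearMap.ker I.mkQ := by
      rw [Submodule.ker_mkQ]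
      exact (Submodule.Quotient.mk_eq_zero _).1 hx
    rw [← Submodule.range_subtype (LinearMap.ker I.mkQ), LinearMap.range_eq_map,
      ← Submodule.map_smul''] at hx1
    obtain ⟨y, hy, hyx⟩ := hx1
    exact (Subtype.ext hyx : y = ⟨_, hx'⟩) ▸ hy

end Vanishing

section Colimit

variable {R : Type u} [CommRing R]

/-- The class `e` becomes zero in the colimit of `Ext i (R ⧸ I) M` over the ideals `I` whose
radical contains `𝔞`. -/
def ExtQuotVanishes (𝔞 : Ideal R) {I : Ideal R} {M : ModuleCat.{u} R} {i : ℕ}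
    (e : Ext (ModuleCat.of R (R ⧸ I)) M i) : Prop :=
  ∃ (K : Ideal R) (h : K ≤ I), 𝔞 ≤ K.radical ∧ extQuotRes h M i e = 0

variable {𝔞 𝔟 : Ideal R} {M : ModuleCat.{u} R} {i : ℕ}

theorem le_radical_inf {I J : Ideal R} (hI : 𝔞 ≤ I.radical) (hJ : 𝔞 ≤ J.radical) :
    𝔞 ≤ (I ⊓ J).radical := by
  rw [Ideal.radical_inf]
  exact le_inf hI hJ

namespace ExtQuotVanishes

theorem of_extQuotRes {I J : Ideal R} {h : I ≤ J} {e : Ext (ModuleCat.of R (R ⧸ J)) M i}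
    (he : ExtQuotVanishes 𝔞 (extQuotRes h M i e)) : ExtQuotVanishes 𝔞 e := by
  obtain ⟨K, hK, hK', h0⟩ := he
  exact ⟨K, hK.trans h, hK', by rwa [extQuotRes_extQuotRes] at h0⟩

theorem extQuotRes {I J : Ideal R} {e : Ext (ModuleCat.of R (R ⧸ J)) M i}
    (he : ExtQuotVanishes 𝔞 e) (h : I ≤ J) (hI : 𝔞 ≤ I.radical) :
    ExtQuotVanishes 𝔞 (extQuotRes h M i e) := by
  obtain ⟨K, hK, hK', h0⟩ := he
  refine ⟨K ⊓ I, inf_le_right, le_radical_inf hK' hI, ?_⟩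
  rw [extQuotRes_extQuotRes, ← extQuotRes_extQuotRes inf_le_left hK, h0, map_zero]

theorem smul {I : Ideal R} {e : Ext (ModuleCat.of R (R ⧸ I)) M i}
    (he : ExtQuotVanishes 𝔞 e) (c : R) : ExtQuotVanishes 𝔞 (c • e) := by
  obtain ⟨K, hK, hK', h0⟩ := he
  exact ⟨K, hK, hK', by rw [map_smul, h0, smul_zero]⟩

theorem comp {I : Ideal R} {e : Ext (ModuleCat.of R (R ⧸ I)) M i}
    (he : ExtQuotVanishes 𝔞 e) {N : ModuleCat.{u} R} {j k : ℕ} (f : Ext M N j) (hk : i + j = k) :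
    ExtQuotVanishes 𝔞 (e.comp f hk) := by
  obtain ⟨K, hK, hK', h0⟩ := he
  exact ⟨K, hK, hK', by rw [extQuotRes_comp, h0, Ext.zero_comp]⟩

theorem exists_middle {S : ShortComplex (ModuleCat.{u} R)} (hS : S.ShortExact) {I : Ideal R}
    {e : Ext (ModuleCat.of R (R ⧸ I)) S.X₃ i} {c : R}
    (he : ExtQuotVanishes 𝔞 (c • e.comp hS.extClass rfl)) :
    ∃ (K : Ideal R) (_ : 𝔞 ≤ K.radical) (b : Ext (ModuleCat.of R (R ⧸ K)) S.X₂ i),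
      ∀ d : R, ExtQuotVanishes 𝔞 (d • b) → ExtQuotVanishes 𝔞 ((d * c) • e) := by
  obtain ⟨K, hK, hK', h0⟩ := he
  rw [← Ext.smul_comp, extQuotRes_comp] at h0
  obtain ⟨b, hb⟩ := Ext.covariant_sequence_exact₃ _ hS _ rfl h0
  refine ⟨K, hK', b, fun d hd ↦ of_extQuotRes (h := hK) ?_⟩
  rw [mul_smul, map_smul, ← hb, ← Ext.smul_comp]
  exact hd.comp _ _

end ExtQuotVanishes

/-- Every class of the `𝔞`-local cohomology of `M` in degree `i` is `𝔟`-torsion. -/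
def ExtQuotTorsion (𝔞 𝔟 : Ideal R) (M : ModuleCat.{u} R) (i : ℕ) : Prop :=
  ∀ y ∈ 𝔟, ∀ I : Ideal R, 𝔞 ≤ I.radical → ∀ e : Ext (ModuleCat.of R (R ⧸ I)) M i,
    ∃ k : ℕ, ExtQuotVanishes 𝔞 (y ^ k • e)

/-- The radical of the annihilator of the `𝔞`-local cohomology of `M` in degree `i`
contains `𝔞`. -/
def ExtQuotUniformTorsion (𝔞 : Ideal R) (M : ModuleCat.{u} R) (i : ℕ) : Prop :=
  ∀ y ∈ 𝔞, ∃ k : ℕ, ∀ I : Ideal R, 𝔞 ≤ I.radical → ∀ e : Ext (ModuleCat.of R (R ⧸ I)) M i,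
    ExtQuotVanishes 𝔞 (y ^ k • e)

theorem ExtQuotTorsion.X₃ {S : ShortComplex (ModuleCat.{u} R)} (hS : S.ShortExact)
    (h₂ : ExtQuotTorsion 𝔞 𝔟 S.X₂ i) (h₁ : ExtQuotTorsion 𝔞 𝔟 S.X₁ (i + 1)) :
    ExtQuotTorsion 𝔞 𝔟 S.X₃ i := by
  intro y hy I hI e
  obtain ⟨k, hk⟩ := h₁ y hy I hI (e.comp hS.extClass rfl)
  obtain ⟨K, hK, b, hb⟩ := hk.exists_middle hS
  obtain ⟨l, hl⟩ := h₂ y hy K hK b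
  exact ⟨l + k, by simpa [pow_add] using hb _ hl⟩

theorem ExtQuotUniformTorsion.X₃ {S : ShortComplex (ModuleCat.{u} R)} (hS : S.ShortExact)
    (h₂ : ExtQuotUniformTorsion 𝔞 S.X₂ i) (h₁ : ExtQuotUniformTorsion 𝔞 S.X₁ (i + 1)) :
    ExtQuotUniformTorsion 𝔞 S.X₃ i := by
  intro y hy
  obtain ⟨k, hk⟩ := h₁ y hy
  obtain ⟨l, hl⟩ := h₂ y hy
  refine ⟨l + k, fun I hI e ↦ ?_⟩
  obtain ⟨K, hK, b, hb⟩ := (hk I hI (e.comp hS.extClass rfl)).exists_middle hS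
  simpa [pow_add] using hb _ (hl K hK b)

theorem exists_comp_extClass_eq_of_smul_eq_zero {y : R} (hy : IsSMulRegular M y) {I : Ideal R}
    {e : Ext (ModuleCat.of R (R ⧸ I)) M (i + 1)} (he : y • e = 0) :
    ∃ g : Ext (ModuleCat.of R (R ⧸ I)) (M.smulShortComplex y).X₃ i,
      g.comp hy.smulShortComplex_shortExact.extClass rfl = e := by
  refine Ext.covariant_sequence_exact₁ _ hy.smulShortComplex_shortExact e ?_ rfl
  rwa [Ext.smul_eq_comp_mk₀] at he

section Noetherian

variable [IsNoetherianRing R]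

theorem extQuotUniformTorsion_of_le_radical_annihilator
    (hM : 𝔞 ≤ (Module.annihilator R M).radical) (i : ℕ) :
    ExtQuotUniformTorsion 𝔞 M (i + 1) := fun _ _ ↦ ⟨0, fun _ hI e ↦ by
  obtain ⟨K, h, hK, h0⟩ := exists_forall_extQuotRes_eq_zero hM i hI
  exact ⟨K, h, hK, h0 _⟩⟩

theorem extQuotTorsion_of_le_radical_annihilator (𝔟 : Ideal R)
    (hM : 𝔞 ≤ (Module.annihilator R M).radical) (i : ℕ) :
    ExtQuotTorsion 𝔞 𝔟 M (i + 1) := fun _ _ _ hI e ↦ ⟨0, by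
  obtain ⟨K, h, hK, h0⟩ := exists_forall_extQuotRes_eq_zero hM i hI
  exact ⟨K, h, hK, h0 _⟩⟩

/-- Classes agreeing after passing to the quotient by an `𝔞`-torsion submodule agree in the
colimit. -/
theorem exists_extQuotRes_eq_of_comp_g_eq {S : ShortComplex (ModuleCat.{u} R)} (hS : S.ShortExact)
    (hT : 𝔞 ≤ (Module.annihilator R S.X₁).radical) {I L K : Ideal R} (hI : K ≤ I) (hL : K ≤ L)
    (hK : 𝔞 ≤ K.radical) (e : Ext (ModuleCat.of R (R ⧸ I)) S.X₂ (i + 1))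
    (e' : Ext (ModuleCat.of R (R ⧸ L)) S.X₂ (i + 1))
    (h : extQuotRes hI S.X₃ (i + 1) (e.comp (Ext.mk₀ S.g) (add_zero _)) =
      extQuotRes hL S.X₃ (i + 1) (e'.comp (Ext.mk₀ S.g) (add_zero _))) :
    ∃ (K' : Ideal R) (h : K' ≤ K), 𝔞 ≤ K'.radical ∧
      extQuotRes (h.trans hI) S.X₂ (i + 1) e = extQuotRes (h.trans hL) S.X₂ (i + 1) e' := by
  have h0 : (extQuotRes hI S.X₂ (i + 1) e - extQuotRes hL S.X₂ (i + 1) e').comp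
      (Ext.mk₀ S.g) (add_zero _) = 0 := by
    rw [sub_eq_add_neg, Ext.add_comp, Ext.neg_comp, ← extQuotRes_comp, ← extQuotRes_comp, h,
      add_neg_cancel]
  obtain ⟨t, ht⟩ := Ext.covariant_sequence_exact₂ _ hS _ h0
  obtain ⟨K', h', hK', h0'⟩ := exists_forall_extQuotRes_eq_zero hT i hK
  refine ⟨K', h', hK', ?_⟩
  rw [← sub_eq_zero, ← extQuotRes_extQuotRes h' hI, ← extQuotRes_extQuotRes h' hL, ← map_sub, ← ht,
    extQuotRes_comp, h0', Ext.zero_comp]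

end Noetherian

end Colimit

section Descent

variable {R : Type u} [CommRing R] {𝔞 𝔟 : Ideal R}

theorem exists_pow_smul_eq_zero_of_extQuotTorsion {M : ModuleCat.{u} R}
    (hM : ExtQuotTorsion 𝔞 𝔟 M 0) {v : M} (hv : v ∈ idealTorsion 𝔞 M) {y : R} (hy : y ∈ 𝔟) :
    ∃ k : ℕ, y ^ k • v = 0 := by
  have hI : 𝔞 ≤ (Ideal.torsionOf R M v).radical := hv
  obtain ⟨k, K, hK, -, h0⟩ := hM y hy _ hI (extZeroMk v fun a ↦ (Ideal.mem_torsionOf_iff v a).1)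
  rw [smul_extZeroMk, extQuotRes_extZeroMk] at h0
  exact ⟨k, eq_zero_of_extZeroMk_eq_zero _ _ h0⟩

variable [IsNoetherianRing R]

theorem le_radical_annihilator_idealTorsion (𝔞 : Ideal R) (M : Type u) [AddCommGroup M]
    [Module R M] [Module.Finite R M] :
    𝔞 ≤ (Module.annihilator R (idealTorsion 𝔞 M)).radical :=
  le_radical_annihilator_of_forall_exists 𝔞 fun a ha v ↦ by
    obtain ⟨k, hk⟩ := v.2 a ha
    exact ⟨k, Subtype.ext hk⟩

theorem exists_forall_comp_g_eq_extQuotRes {S : ShortComplex (ModuleCat.{u} R)}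
    (hS : S.ShortExact) (hT : 𝔟 ≤ (Module.annihilator R S.X₁).radical) {L : Ideal R}
    (hL : 𝔟 ≤ L.radical) (i : ℕ) :
    ∃ (L' : Ideal R) (h : L' ≤ L), 𝔟 ≤ L'.radical ∧
      ∀ f : Ext (ModuleCat.of R (R ⧸ L)) S.X₃ i,
        ∃ e : Ext (ModuleCat.of R (R ⧸ L')) S.X₂ i,
          e.comp (Ext.mk₀ S.g) (add_zero i) = extQuotRes h S.X₃ i f := by
  obtain ⟨L', h, hL', h0⟩ := exists_forall_extQuotRes_eq_zero hT i hL
  refine ⟨L', h, hL', fun f ↦ Ext.covariant_sequence_exact₃ _ hS _ rfl ?_⟩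
  rw [← extQuotRes_comp, h0]

/-- Two classes with values in `S.X₂` agree in the colimit as soon as their images in `S.X₃` are
the products with `δ` of classes that agree in the colimit. -/
theorem exists_extQuotRes_eq_of_comp_extClass_eq {S : ShortComplex (ModuleCat.{u} R)}
    (hS : S.ShortExact) (hT : 𝔞 ≤ (Module.annihilator R S.X₁).radical) {N : ModuleCat.{u} R}
    (δ : Ext N S.X₃ 1) {i : ℕ} {I L L' K : Ideal R}
    {g : Ext (ModuleCat.of R (R ⧸ I)) N i}
    {g' : Ext (ModuleCat.of R (R ⧸ L)) N i}
    {e : Ext (ModuleCat.of R (R ⧸ I)) S.X₂ (i + 1)}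
    {e' : Ext (ModuleCat.of R (R ⧸ L')) S.X₂ (i + 1)}
    (hg : e.comp (Ext.mk₀ S.g) (add_zero _) =
      g.comp δ rfl)
    (hL' : L' ≤ L) (hL'' : 𝔞 ≤ L'.radical)
    (hg' : e'.comp (Ext.mk₀ S.g) (add_zero _) =
      extQuotRes hL' S.X₃ _ (g'.comp δ rfl))
    (hKI : K ≤ I) (hKL : K ≤ L) (hK : 𝔞 ≤ K.radical)
    (h : extQuotRes hKL _ _ g' = extQuotRes hKI _ _ g) :
    ∃ (K' : Ideal R) (h : K' ≤ I) (h' : K' ≤ L'), 𝔞 ≤ K'.radical ∧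
      extQuotRes h S.X₂ (i + 1) e = extQuotRes h' S.X₂ (i + 1) e' := by
  obtain ⟨K', h1, h2, h3⟩ := exists_extQuotRes_eq_of_comp_g_eq hS hT
    (inf_le_left.trans hKI : K ⊓ L' ≤ I) inf_le_right (le_radical_inf hK hL'') e e' (by
      rw [hg, hg', extQuotRes_extQuotRes, extQuotRes_comp, extQuotRes_comp,
        ← extQuotRes_extQuotRes inf_le_left hKI, ← h, extQuotRes_extQuotRes])
  exact ⟨K', _, _, h2, h3⟩

/-- If the `𝔞`-local cohomology of `M` is `𝔟`-torsion in degrees up to `r`, then each of its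
classes of degree `r` comes from `Ext r (R ⧸ L) M` with `L` containing a power of `𝔟`. -/
theorem exists_extQuotRes_eq_of_extQuotTorsion (h𝔟 : 𝔞 ≤ 𝔟) (r : ℕ) (M : ModuleCat.{u} R)
    [Module.Finite R M] (hM : ∀ i ≤ r, ExtQuotTorsion 𝔞 𝔟 M i) {I : Ideal R} (hI : 𝔞 ≤ I.radical)
    (e : Ext (ModuleCat.of R (R ⧸ I)) M r) :
    ∃ (L K : Ideal R) (hKI : K ≤ I) (hKL : K ≤ L) (e' : Ext (ModuleCat.of R (R ⧸ L)) M r),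
      𝔟 ≤ L.radical ∧ 𝔞 ≤ K.radical ∧ extQuotRes hKL M r e' = extQuotRes hKI M r e := by
  induction r generalizing M I with
  | zero =>
    obtain ⟨v, hv, rfl⟩ := exists_extZeroMk e
    refine ⟨Ideal.torsionOf R M v, I, le_rfl, fun a ha ↦ (Ideal.mem_torsionOf_iff v a).2 (hv a ha),
      extZeroMk v fun a ↦ (Ideal.mem_torsionOf_iff v a).1, fun y hy ↦ ?_, hI, ?_⟩
    · refine exists_pow_smul_eq_zero_of_extQuotTorsion (hM 0 le_rfl) (fun a ha ↦ ?_) hy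
      obtain ⟨k, hk⟩ := hI ha
      exact ⟨k, hv _ hk⟩
    · rw [extQuotRes_extZeroMk, extQuotRes_extZeroMk]
  | succ r ih =>
    have hS := LinearMap.shortExact_shortComplexKer (idealTorsion 𝔞 M).mkQ_surjective
    set S := (idealTorsion 𝔞 M).mkQ.shortComplexKer
    have hT : 𝔟 ≤ (Module.annihilator R S.X₁).radical := by
      refine le_radical_annihilator_of_forall_exists (M := LinearMap.ker (idealTorsion 𝔞 M).mkQ) _
        fun y hy v ↦ ?_
      obtain ⟨k, hk⟩ := exists_pow_smul_eq_zero_of_extQuotTorsion (hM 0 (Nat.zero_le _))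
        ((Submodule.Quotient.mk_eq_zero _).1 v.2) hy
      exact ⟨k, Subtype.ext hk⟩
    have hM' (i : ℕ) (hi : i ≤ r + 1) : ExtQuotTorsion 𝔞 𝔟 S.X₃ i :=
      (hM i hi).X₃ hS (extQuotTorsion_of_le_radical_annihilator 𝔟 (h𝔟.trans hT) i)
    obtain ⟨x, hx, hx'⟩ := exists_isSMulRegular_of_idealTorsion_eq_bot 𝔞
      (idealTorsion_quotient_eq_bot 𝔞 M)
    obtain ⟨n, hn⟩ := hI hx
    have hy : IsSMulRegular S.X₃ (x ^ n) := hx'.pow n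
    have : Module.Finite R S.X₃ := inferInstanceAs (Module.Finite R (M ⧸ idealTorsion 𝔞 M))
    obtain ⟨g, hg⟩ := exists_comp_extClass_eq_of_smul_eq_zero hy
      (smul_ext_eq_zero_of_mem (e.comp (Ext.mk₀ S.g) (add_zero _)) hn)
    have : Module.Finite R (S.X₃.smulShortComplex (x ^ n)).X₃ :=
      inferInstanceAs (Module.Finite R (QuotSMulTop _ S.X₃))
    obtain ⟨L, K, hKI, hKL, g', hL, hK, h⟩ := ih (S.X₃.smulShortComplex (x ^ n)).X₃
      (fun i hi ↦ (hM' i (by lia)).X₃ hy.smulShortComplex_shortExact (hM' (i + 1) (by lia))) hI g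
    obtain ⟨L', hL', hL'', H⟩ := exists_forall_comp_g_eq_extQuotRes hS hT hL (r + 1)
    obtain ⟨e', he'⟩ := H (g'.comp hy.smulShortComplex_shortExact.extClass rfl)
    obtain ⟨K', h1, h2, h3, h4⟩ := exists_extQuotRes_eq_of_comp_extClass_eq hS (h𝔟.trans hT)
      hy.smulShortComplex_shortExact.extClass hg.symm hL' (h𝔟.trans hL'') he' hKI hKL hK h
    exact ⟨L', K', h1, h2, e', hL'', h3, h4.symm⟩

/-- If the `𝔞`-local cohomology of `M` is killed by a power of `𝔞` in degrees up to `r`, then in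
degree `r` it is the image of a single `Ext r (R ⧸ I) M`. -/
theorem exists_forall_extQuotRes_eq_of_extQuotUniformTorsion (r : ℕ) (M : ModuleCat.{u} R)
    [Module.Finite R M] (hM : ∀ i ≤ r, ExtQuotUniformTorsion 𝔞 M i) :
    ∃ I : Ideal R, 𝔞 ≤ I.radical ∧ ∀ (I' : Ideal R), 𝔞 ≤ I'.radical →
      ∀ e : Ext (ModuleCat.of R (R ⧸ I')) M r,
        ∃ (K : Ideal R) (hK : K ≤ I) (hK' : K ≤ I') (e' : Ext (ModuleCat.of R (R ⧸ I)) M r),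
          𝔞 ≤ K.radical ∧ extQuotRes hK M r e' = extQuotRes hK' M r e := by
  induction r generalizing M with
  | zero =>
    have hT := le_radical_annihilator_idealTorsion 𝔞 M
    refine ⟨_, hT, fun I' hI' e ↦ ?_⟩
    obtain ⟨v, hv, rfl⟩ := exists_extZeroMk e
    have hvT : v ∈ idealTorsion 𝔞 M := fun a ha ↦ by
      obtain ⟨k, hk⟩ := hI' ha
      exact ⟨k, hv _ hk⟩
    refine ⟨_, inf_le_left, inf_le_right, extZeroMk v fun a ha ↦ ?_, le_radical_inf hT hI', ?_⟩
    · exact congr($(Module.mem_annihilator.1 ha ⟨v, hvT⟩).1)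
    · rw [extQuotRes_extZeroMk, extQuotRes_extZeroMk]
  | succ r ih =>
    have hS := LinearMap.shortExact_shortComplexKer (idealTorsion 𝔞 M).mkQ_surjective
    set S := (idealTorsion 𝔞 M).mkQ.shortComplexKer
    have hT : 𝔞 ≤ (Module.annihilator R S.X₁).radical := by
      refine le_radical_annihilator_of_forall_exists (M := LinearMap.ker (idealTorsion 𝔞 M).mkQ) _
        fun y hy v ↦ ?_
      obtain ⟨k, hk⟩ := (Submodule.Quotient.mk_eq_zero _).1 v.2 y hy
      exact ⟨k, Subtype.ext hk⟩
    have hM' (i : ℕ) (hi : i ≤ r + 1) : ExtQuotUniformTorsion 𝔞 S.X₃ i :=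
      (hM i hi).X₃ hS (extQuotUniformTorsion_of_le_radical_annihilator hT i)
    obtain ⟨x, hx, hx'⟩ := exists_isSMulRegular_of_idealTorsion_eq_bot 𝔞
      (idealTorsion_quotient_eq_bot 𝔞 M)
    obtain ⟨n, hn⟩ := hM' (r + 1) le_rfl x hx
    have hy : IsSMulRegular S.X₃ (x ^ n) := hx'.pow n
    have : Module.Finite R S.X₃ := inferInstanceAs (Module.Finite R (M ⧸ idealTorsion 𝔞 M))
    have : Module.Finite R (S.X₃.smulShortComplex (x ^ n)).X₃ :=
      inferInstanceAs (Module.Finite R (QuotSMulTop _ S.X₃))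
    obtain ⟨L, hL, hgen⟩ := ih (S.X₃.smulShortComplex (x ^ n)).X₃
      (fun i hi ↦ (hM' i (by lia)).X₃ hy.smulShortComplex_shortExact (hM' (i + 1) (by lia)))
    obtain ⟨L', hL', hL'', H⟩ := exists_forall_comp_g_eq_extQuotRes hS hT hL (r + 1)
    refine ⟨L', hL'', fun I' hI' e ↦ ?_⟩
    obtain ⟨I, hII', hI, h0⟩ := hn I' hI' (e.comp (Ext.mk₀ S.g) (add_zero _))
    rw [map_smul, extQuotRes_comp] at h0
    obtain ⟨g, hg⟩ := exists_comp_extClass_eq_of_smul_eq_zero hy h0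
    obtain ⟨K, hKL, hKI, g', hK, h⟩ := hgen I hI g
    obtain ⟨e', he'⟩ := H (g'.comp hy.smulShortComplex_shortExact.extClass rfl)
    obtain ⟨K', h1, h2, h3, h4⟩ := exists_extQuotRes_eq_of_comp_extClass_eq hS hT
      hy.smulShortComplex_shortExact.extClass hg.symm hL' hL'' he' hKI hKL hK h
    exact ⟨K', h2, h1.trans hII', e', h3, by rw [← h4, extQuotRes_extQuotRes]⟩

end Descent

theorem exists_linearEquiv_of_ker_eq {R A B C : Type*} [CommRing R] [AddCommGroup A] [Module R A]
    [AddCommGroup B] [Module R B] [AddCommGroup C] [Module R C] {f : A →ₗ[R] B} {g : A →ₗ[R] C}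
    (hf : Function.Surjective f) (hg : Function.Surjective g)
    (h : LinearMap.ker f = LinearMap.ker g) : ∃ e : B ≃ₗ[R] C, ∀ z, e (f z) = g z := by
  refine ⟨(f.quotKerEquivOfSurjective hf).symm ≪≫ₗ Submodule.quotEquivOfEq _ _ h ≪≫ₗ
    g.quotKerEquivOfSurjective hg, fun z ↦ ?_⟩
  have : (f.quotKerEquivOfSurjective hf).symm (f z) = Submodule.Quotient.mk z := by
    rw [LinearEquiv.symm_apply_eq]
    rfl
  rw [LinearEquiv.trans_apply, LinearEquiv.trans_apply, this]
  rfl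

section Comparison

variable {R : Type u} [CommRing R] {X X' : ModuleCat.{u} R} (Y : ModuleCat.{u} R)

/-- The map of cochain complexes `Hom(P, Y) → Hom(P', Y)` induced by a chain map `P' → P`. -/
noncomputable def linearYonedaObjMap {C C' : ChainComplex (ModuleCat.{u} R) ℕ} (φ : C' ⟶ C) :
    C.linearYonedaObj R Y ⟶ C'.linearYonedaObj R Y :=
  (HomologicalComplex.unopFunctor _ _).map
    ((((linearYoneda R (ModuleCat.{u} R)).obj Y).rightOp.mapHomologicalComplex _).map φ).op

theorem isoExt_hom_naturality {P : ProjectiveResolution X} {P' : ProjectiveResolution X'}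
    {f : X' ⟶ X} (φ : ProjectiveResolution.Hom P' P f) (n : ℕ) :
    ((Ext R (ModuleCat.{u} R) n).map f.op).app Y ≫ (P'.isoExt n Y).hom =
      (P.isoExt n Y).hom ≫ HomologicalComplex.homologyMap (linearYonedaObjMap Y φ.hom) n := by
  have h1 := ProjectiveResolution.isoLeftDerivedObj_inv_naturality f P' P φ.hom
    φ.hom_f_zero_comp_π_f_zero
    ((linearYoneda R (ModuleCat.{u} R)).obj Y).rightOp n
  have h2 := HomologicalComplex.homologyOp_hom_naturality (linearYonedaObjMap Y φ.hom) n
  have h3 := (Iso.eq_comp_inv _).2 ((Category.assoc _ _ _).trans ((Iso.inv_comp_eq _).2 h2))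
  apply Quiver.Hom.op_inj
  change ((P'.complex.linearYonedaObj R Y).homologyOp n).inv ≫
    (P'.isoLeftDerivedObj ((linearYoneda R (ModuleCat.{u} R)).obj Y).rightOp n).inv ≫
    ((((linearYoneda R (ModuleCat.{u} R)).obj Y).rightOp).leftDerived n).map f =
    (HomologicalComplex.homologyMap (linearYonedaObjMap Y φ.hom) n).op ≫
    ((P.complex.linearYonedaObj R Y).homologyOp n).inv ≫
    (P.isoLeftDerivedObj ((linearYoneda R (ModuleCat.{u} R)).obj Y).rightOp n).inv
  refine (congrArg (_ ≫ ·) h1).trans ?_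
  exact (Category.assoc _ _ _).symm.trans ((congrArg (· ≫ _) h3).trans (Category.assoc _ _ _))

theorem extMk_zero_eq_zero_iff (P : ProjectiveResolution X) (f : P.complex.X 0 ⟶ Y)
    (hf : P.complex.d 1 0 ≫ f = 0) : P.extMk f 1 rfl hf = 0 ↔ f = 0 := by
  refine ⟨fun h ↦ ?_, fun h ↦ by subst h; simp⟩
  rw [← P.extEquivCohomologyClass.apply_eq_iff_eq, P.extEquivCohomologyClass_extMk,
    P.extEquivCohomologyClass_zero, CochainComplex.HomComplex.CohomologyClass.mk_eq_zero_iff,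
    CochainComplex.HomComplex.Cocycle.toSingleMk_mem_coboundaries_iff _ _ _ _ _ 1 (by lia)] at h
  obtain ⟨g, hg⟩ := h
  rw [(P.cochainComplex.isZero_of_isStrictlyLE 0 1).eq_of_src g 0, Limits.comp_zero] at hg
  rw [← cancel_epi (P.cochainComplexXIso (-(0 : ℕ)) 0 rfl).hom, ← hg, Limits.comp_zero]

variable {Y} (P : ProjectiveResolution X) (n : ℕ)

theorem smul_extMk (c : R) (f : P.complex.X n ⟶ Y) (m : ℕ) (hm : n + 1 = m)
    (hf : P.complex.d m n ≫ f = 0) :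
    c • P.extMk f m hm hf = P.extMk (c • f) m hm (by rw [Linear.comp_smul, hf, smul_zero]) := by
  rw [Ext.smul_eq_comp_mk₀, P.extMk_comp_mk₀]
  congr 1

variable {P n} in
/-- The map `P_n → Y` underlying a cocycle of the complex `Hom(P, Y)`. -/
noncomputable def cocycleHom (z : (P.complex.linearYonedaObj R Y).cycles n) : P.complex.X n ⟶ Y :=
  (P.complex.linearYonedaObj R Y).iCycles n z

theorem cocycleHom_add (z w : (P.complex.linearYonedaObj R Y).cycles n) :
    cocycleHom (z + w) = cocycleHom z + cocycleHom w :=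
  map_add ((P.complex.linearYonedaObj R Y).iCycles n).hom z w

theorem cocycleHom_smul (c : R) (z : (P.complex.linearYonedaObj R Y).cycles n) :
    cocycleHom (c • z) = c • cocycleHom z :=
  map_smul ((P.complex.linearYonedaObj R Y).iCycles n).hom c z

theorem cocycleHom_injective :
    Function.Injective (cocycleHom : (P.complex.linearYonedaObj R Y).cycles n → _) :=
  (ModuleCat.mono_iff_injective ((P.complex.linearYonedaObj R Y).iCycles n)).1 inferInstance

theorem cocycleHom_zero : cocycleHom (0 : (P.complex.linearYonedaObj R Y).cycles n) = 0 :=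
  map_zero ((P.complex.linearYonedaObj R Y).iCycles n).hom

theorem cocycleHom_toCycles (g : P.complex.X n ⟶ Y) :
    cocycleHom ((P.complex.linearYonedaObj R Y).toCycles n (n + 1) g) =
      P.complex.d (n + 1) n ≫ g :=
  congr($((P.complex.linearYonedaObj R Y).toCycles_i n (n + 1)).hom g)

theorem d_comp_cocycleHom (z : (P.complex.linearYonedaObj R Y).cycles n) :
    P.complex.d (n + 1) n ≫ cocycleHom z = 0 :=
  congr($((P.complex.linearYonedaObj R Y).iCycles_d n (n + 1)).hom z)

theorem cocycleHom_cyclesMap (P' : ProjectiveResolution X') (φ : P'.complex ⟶ P.complex)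
    (z : (P.complex.linearYonedaObj R Y).cycles n) :
    cocycleHom (HomologicalComplex.cyclesMap (linearYonedaObjMap Y φ) n z) =
      φ.f n ≫ cocycleHom z :=
  congr($(HomologicalComplex.cyclesMap_i (linearYonedaObjMap Y φ) n).hom z)

variable (Y) in
/-- The `Ext` class of a cocycle of the complex `Hom(P, Y)`. -/
noncomputable def cyclesToExt :
    (P.complex.linearYonedaObj R Y).cycles n →ₗ[R] Abelian.Ext X Y n where
  toFun z := P.extMk (cocycleHom z) (n + 1) rfl (d_comp_cocycleHom P n z)
  map_add' z w := by
    rw [P.add_extMk]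
    congr 1
    exact cocycleHom_add P n z w
  map_smul' c z := by
    rw [RingHom.id_apply, smul_extMk]
    congr 1
    exact cocycleHom_smul P n c z

theorem cyclesToExt_apply (z : (P.complex.linearYonedaObj R Y).cycles n) :
    cyclesToExt Y P n z = P.extMk (cocycleHom z) (n + 1) rfl (d_comp_cocycleHom P n z) := rfl

theorem cyclesToExt_surjective : Function.Surjective (cyclesToExt Y P n) := by
  intro e
  obtain ⟨f, hf, rfl⟩ := P.extMk_surjective e (n + 1) rfl
  let k : ModuleCat.of R R ⟶ (P.complex.linearYonedaObj R Y).X n :=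
    ModuleCat.ofHom (LinearMap.toSpanSingleton R _ f)
  have hk : k ≫ (P.complex.linearYonedaObj R Y).d n (n + 1) = 0 := by
    ext
    change P.complex.d (n + 1) n ≫ ((1 : R) • f) = 0
    rw [one_smul, hf]
  refine ⟨(P.complex.linearYonedaObj R Y).liftCycles k (n + 1) (by simp) hk (1 : R), ?_⟩
  rw [cyclesToExt_apply]
  congr 1
  refine congr($((P.complex.linearYonedaObj R Y).liftCycles_i k (n + 1) (by simp) hk).hom
    (1 : R)).trans ?_
  exact one_smul R f

theorem cyclesToExt_eq_zero_iff (z : (P.complex.linearYonedaObj R Y).cycles n) :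
    cyclesToExt Y P n z = 0 ↔ (P.complex.linearYonedaObj R Y).homologyπ n z = 0 := by
  rw [cyclesToExt_apply]
  cases n with
  | zero =>
    have hπ : Function.Injective ((P.complex.linearYonedaObj R Y).homologyπ 0) := by
      rw [← ModuleCat.mono_iff_injective]
      infer_instance
    rw [map_eq_zero_iff _ hπ]
    refine (extMk_zero_eq_zero_iff Y P _ _).trans ?_
    rw [← (cocycleHom_injective P 0).eq_iff, cocycleHom_zero]
  | succ p =>
    rw [P.extMk_eq_zero_iff _ _ _ _ p rfl]
    constructor
    · rintro ⟨g, hg⟩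
      rw [← cocycleHom_toCycles] at hg
      rw [← cocycleHom_injective P _ hg]
      exact congr($((P.complex.linearYonedaObj R Y).toCycles_comp_homologyπ p (p + 1)).hom g)
    · intro h
      have hex : (ShortComplex.mk _ _
          ((P.complex.linearYonedaObj R Y).toCycles_comp_homologyπ p (p + 1))).Exact :=
        ShortComplex.exact_of_g_is_cokernel _
          ((P.complex.linearYonedaObj R Y).homologyIsCokernel p (p + 1) (by simp))
      obtain ⟨g, rfl⟩ := (ShortComplex.moduleCat_exact_iff _).1 hex z h
      exact ⟨g, (cocycleHom_toCycles P p g).symm⟩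

variable (Y) in
theorem exists_linearEquiv_homology :
    ∃ e : (P.complex.linearYonedaObj R Y).homology n ≃ₗ[R] Abelian.Ext X Y n,
      ∀ z, e ((P.complex.linearYonedaObj R Y).homologyπ n z) = cyclesToExt Y P n z := by
  exact exists_linearEquiv_of_ker_eq (f := ((P.complex.linearYonedaObj R Y).homologyπ n).hom)
    ((ModuleCat.epi_iff_surjective _).1 inferInstance) (cyclesToExt_surjective P n)
    (Submodule.ext fun z ↦ (cyclesToExt_eq_zero_iff P n z).symm)

variable (X Y) in
/-- The `Ext` modules defined by deriving `Hom(-, Y)` are those defined in terms of the derived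
category. -/
noncomputable def extLinearEquiv :
    ((Ext R (ModuleCat.{u} R) n).obj (op X)).obj Y ≃ₗ[R] Abelian.Ext X Y n :=
  ((projectiveResolution X).isoExt n Y).toLinearEquiv ≪≫ₗ
    (exists_linearEquiv_homology Y (projectiveResolution X) n).choose

variable (Y) in
theorem extLinearEquiv_naturality (f : X' ⟶ X)
    (e : ((Ext R (ModuleCat.{u} R) n).obj (op X)).obj Y) :
    extLinearEquiv X' Y n (((Ext R (ModuleCat.{u} R) n).map f.op).app Y e) =
      (Ext.mk₀ f).comp (extLinearEquiv X Y n e) (zero_add n) := by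
  let P := projectiveResolution X
  let P' := projectiveResolution X'
  let φ : ProjectiveResolution.Hom P' P f :=
    ⟨ProjectiveResolution.lift f P' P,
      HomologicalComplex.congr_hom (ProjectiveResolution.lift_commutes f P' P) 0⟩
  obtain ⟨z, hz⟩ := (ModuleCat.epi_iff_surjective
    ((P.complex.linearYonedaObj R Y).homologyπ n)).1 inferInstance ((P.isoExt n Y).hom e)
  have h1 : (P'.isoExt n Y).hom (((Ext R (ModuleCat.{u} R) n).map f.op).app Y e) =
      (P'.complex.linearYonedaObj R Y).homologyπ n
        (HomologicalComplex.cyclesMap (linearYonedaObjMap Y φ.hom) n z) := by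
    refine congr($(isoExt_hom_naturality Y φ n).hom e).trans ?_
    change HomologicalComplex.homologyMap (linearYonedaObjMap Y φ.hom) n ((P.isoExt n Y).hom e) = _
    rw [← hz]
    exact congr($(HomologicalComplex.homologyπ_naturality (linearYonedaObjMap Y φ.hom) n).hom z)
  have h2 : extLinearEquiv X Y n e = cyclesToExt Y P n z :=
    (congrArg _ hz.symm).trans ((exists_linearEquiv_homology Y P n).choose_spec z)
  have h3 := (congrArg (exists_linearEquiv_homology Y P' n).choose h1).trans
    ((exists_linearEquiv_homology Y P' n).choose_spec _)
  refine h3.trans ?_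
  rw [h2, cyclesToExt_apply, cyclesToExt_apply, ProjectiveResolution.mk₀_comp_extMk _ _ _ _ φ]
  congr 1
  exact cocycleHom_cyclesMap P n P' φ.hom z

end Comparison

section LocalCohomology

variable {R : Type u} [CommRing R]

theorem exists_pow_smul_eq_zero_of_isArtinian [IsLocalRing R] {N : Type*} [AddCommGroup N]
    [Module R N] [IsArtinian R N] {y : R} (hy : y ∈ IsLocalRing.maximalIdeal R) (v : N) :
    ∃ k : ℕ, y ^ k • v = 0 := by
  obtain ⟨k, w, hw⟩ := IsArtinian.exists_pow_succ_smul_dvd y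
    (⟨v, Submodule.mem_span_singleton_self v⟩ : Submodule.span R {v})
  obtain ⟨c, hc⟩ := Submodule.mem_span_singleton.1 w.2
  have hw' : y ^ (k + 1) • c • v = y ^ k • v := hc ▸ congrArg Subtype.val hw
  have hu : IsUnit (1 - y * c) := by
    by_contra hn
    have h1 := Ideal.add_mem _ ((IsLocalRing.mem_maximalIdeal _).2 hn)
      (Ideal.mul_mem_right c _ hy)
    rw [sub_add_cancel] at h1
    exact (Ideal.ne_top_iff_one _).1 (IsLocalRing.maximalIdeal.isMaximal R).ne_top h1
  refine ⟨k, (hu.smul_eq_zero).1 ?_⟩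
  have h2 : (y * c) • y ^ k • v = y ^ (k + 1) • c • v := by
    rw [smul_smul, smul_smul]
    congr 1
    ring
  rw [sub_smul, one_smul, h2, hw', sub_self]

/-- The structure map from `Ext i (R ⧸ 𝔞 ^ t) M` to local cohomology. -/
noncomputable def extToLocalCohomology (𝔞 : Ideal R) (M : ModuleCat.{u} R) (i t : ℕ) :
    Abelian.Ext (ModuleCat.of R (R ⧸ 𝔞 ^ t)) M i →ₗ[R] (localCohomology 𝔞 i).obj M :=
  ((Limits.colimit.ι (localCohomology.diagram (localCohomology.idealPowersDiagram 𝔞) i)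
    (op (op t))).app M).hom.comp
      (extLinearEquiv (ModuleCat.of R (R ⧸ 𝔞 ^ t)) M i).symm.toLinearMap

variable (𝔞 : Ideal R) (M : ModuleCat.{u} R) (i : ℕ)

/-- The direct system of modules whose colimit is local cohomology. -/
noncomputable abbrev extQuotDiagram : ℕᵒᵖᵒᵖ ⥤ ModuleCat.{u} R :=
  localCohomology.diagram (localCohomology.idealPowersDiagram 𝔞) i ⋙ (evaluation _ _).obj M

/-- Local cohomology as a cocone over `extQuotDiagram`. -/
noncomputable abbrev localCohomologyCocone : Limits.Cocone (extQuotDiagram 𝔞 M i) :=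
  ((evaluation _ _).obj M).mapCocone (Limits.colimit.cocone
    (localCohomology.diagram (localCohomology.idealPowersDiagram 𝔞) i))

/-- Local cohomology is the colimit of `extQuotDiagram`. -/
noncomputable def localCohomologyCoconeIsColimit :
    Limits.IsColimit (localCohomologyCocone 𝔞 M i) :=
  Limits.isColimitOfPreserves ((evaluation _ _).obj M) (Limits.colimit.isColimit _)

instance : Limits.PreservesColimit (extQuotDiagram 𝔞 M i) (forget (ModuleCat.{u} R)) :=
  have := Limits.preservesSmallestFilteredColimits_of_preservesFilteredColimits
    (forget (ModuleCat.{u} R))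
  inferInstance

theorem extLinearEquiv_extQuotDiagram_map {t s : ℕᵒᵖᵒᵖ} (f : t ⟶ s)
    (x : (extQuotDiagram 𝔞 M i).obj t) :
    extLinearEquiv (ModuleCat.of R (R ⧸ 𝔞 ^ s.unop.unop)) M i ((extQuotDiagram 𝔞 M i).map f x) =
      extQuotRes (Ideal.pow_le_pow_right f.unop.unop.down.down) M i
        (extLinearEquiv (ModuleCat.of R (R ⧸ 𝔞 ^ t.unop.unop)) M i x) :=
  extLinearEquiv_naturality M i
    ((localCohomology.ringModIdeals (localCohomology.idealPowersDiagram 𝔞)).map f.unop) x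

variable {𝔞 M i}

theorem extToLocalCohomology_extLinearEquiv (t : ℕᵒᵖᵒᵖ) (x : (extQuotDiagram 𝔞 M i).obj t) :
    extToLocalCohomology 𝔞 M i t.unop.unop
      (extLinearEquiv (ModuleCat.of R (R ⧸ 𝔞 ^ t.unop.unop)) M i x) =
      (localCohomologyCocone 𝔞 M i).ι.app t x :=
  congrArg ((localCohomologyCocone 𝔞 M i).ι.app t) (LinearEquiv.symm_apply_apply _ x)

theorem exists_extToLocalCohomology_eq (x : (localCohomology 𝔞 i).obj M) :
    ∃ t e, extToLocalCohomology 𝔞 M i t e = x := by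
  obtain ⟨t, y, hy⟩ := Limits.Concrete.isColimit_exists_rep _
    (localCohomologyCoconeIsColimit 𝔞 M i) x
  exact ⟨_, _, (extToLocalCohomology_extLinearEquiv t y).trans hy⟩

theorem extToLocalCohomology_extQuotRes {t s : ℕ} (hts : t ≤ s)
    (e : Abelian.Ext (ModuleCat.of R (R ⧸ 𝔞 ^ t)) M i) :
    extToLocalCohomology 𝔞 M i s (extQuotRes (Ideal.pow_le_pow_right hts) M i e) =
      extToLocalCohomology 𝔞 M i t e := by
  obtain ⟨x, rfl⟩ := (extLinearEquiv (ModuleCat.of R (R ⧸ 𝔞 ^ t)) M i).surjective e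
  let f : op (op t) ⟶ op (op s) := (homOfLE hts).op.op
  refine (congrArg (extToLocalCohomology 𝔞 M i s)
    (extLinearEquiv_extQuotDiagram_map 𝔞 M i f x)).symm.trans ?_
  refine (extToLocalCohomology_extLinearEquiv (op (op s)) _).trans ?_
  refine .trans ?_ (extToLocalCohomology_extLinearEquiv (op (op t)) x).symm
  exact congr($((localCohomologyCocone 𝔞 M i).w f).hom x)

theorem exists_extQuotRes_eq_zero_of_extToLocalCohomology_eq_zero {t : ℕ}
    {e : Abelian.Ext (ModuleCat.of R (R ⧸ 𝔞 ^ t)) M i}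
    (he : extToLocalCohomology 𝔞 M i t e = 0) :
    ∃ (s : ℕ) (hts : t ≤ s), extQuotRes (Ideal.pow_le_pow_right hts) M i e = 0 := by
  obtain ⟨x, rfl⟩ := (extLinearEquiv (ModuleCat.of R (R ⧸ 𝔞 ^ t)) M i).surjective e
  have hx : (localCohomologyCocone 𝔞 M i).ι.app (op (op t)) x =
      (localCohomologyCocone 𝔞 M i).ι.app (op (op t)) 0 :=
    ((extToLocalCohomology_extLinearEquiv (op (op t)) x).symm.trans he).trans
      (map_zero ((localCohomologyCocone 𝔞 M i).ι.app (op (op t))).hom).symm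
  obtain ⟨s, f, g, h⟩ := Limits.Concrete.isColimit_exists_of_rep_eq _
    (localCohomologyCoconeIsColimit 𝔞 M i) _ _ hx
  refine ⟨s.unop.unop, f.unop.unop.down.down, ?_⟩
  refine (extLinearEquiv_extQuotDiagram_map 𝔞 M i f x).symm.trans ?_
  rw [h]
  exact (congrArg _ (map_zero ((extQuotDiagram 𝔞 M i).map g).hom)).trans (map_zero _)

theorem le_radical_pow (𝔞 : Ideal R) (t : ℕ) : 𝔞 ≤ (𝔞 ^ t).radical :=
  fun _ hx ↦ ⟨t, Ideal.pow_mem_pow hx t⟩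

theorem extQuotVanishes_of_extToLocalCohomology_eq_zero {t : ℕ}
    {e : Abelian.Ext (ModuleCat.of R (R ⧸ 𝔞 ^ t)) M i}
    (he : extToLocalCohomology 𝔞 M i t e = 0) : ExtQuotVanishes 𝔞 e := by
  obtain ⟨s, hts, h⟩ := exists_extQuotRes_eq_zero_of_extToLocalCohomology_eq_zero he
  exact ⟨_, _, le_radical_pow 𝔞 s, h⟩

variable [IsNoetherianRing R]

theorem exists_pow_le_of_le_radical {I : Ideal R} (hI : 𝔞 ≤ I.radical) : ∃ t, 𝔞 ^ t ≤ I :=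
  Ideal.exists_pow_le_of_le_radical_of_fg hI (IsNoetherian.noetherian 𝔞)

theorem extToLocalCohomology_eq_of_extQuotRes_eq {t s : ℕ}
    {e : Abelian.Ext (ModuleCat.of R (R ⧸ 𝔞 ^ t)) M i}
    {e' : Abelian.Ext (ModuleCat.of R (R ⧸ 𝔞 ^ s)) M i} {K : Ideal R} (hK : 𝔞 ≤ K.radical)
    (hKt : K ≤ 𝔞 ^ t) (hKs : K ≤ 𝔞 ^ s) (h : extQuotRes hKt M i e = extQuotRes hKs M i e') :
    extToLocalCohomology 𝔞 M i t e = extToLocalCohomology 𝔞 M i s e' := by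
  obtain ⟨k, hk⟩ := exists_pow_le_of_le_radical hK
  have hl : 𝔞 ^ (t + s + k) ≤ K := (Ideal.pow_le_pow_right (by lia)).trans hk
  rw [← extToLocalCohomology_extQuotRes (show t ≤ t + s + k by lia),
    ← extToLocalCohomology_extQuotRes (show s ≤ t + s + k by lia),
    ← extQuotRes_extQuotRes hl hKt, h, extQuotRes_extQuotRes]

/-- A scalar killing the image of `e` in local cohomology makes `e` vanish in the direct system. -/
theorem extQuotVanishes_smul_of_forall {I : Ideal R} (hI : 𝔞 ≤ I.radical) {c : R}
    (e : Abelian.Ext (ModuleCat.of R (R ⧸ I)) M i)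
    (hc : ∀ t (ht : 𝔞 ^ t ≤ I), c • extToLocalCohomology 𝔞 M i t (extQuotRes ht M i e) = 0) :
    ExtQuotVanishes 𝔞 (c • e) := by
  obtain ⟨t, ht⟩ := exists_pow_le_of_le_radical hI
  refine ExtQuotVanishes.of_extQuotRes (h := ht) ?_
  rw [map_smul]
  exact extQuotVanishes_of_extToLocalCohomology_eq_zero (by rw [map_smul, hc])

theorem finite_localCohomology [Module.Finite R M] {I : Ideal R} (hI : 𝔞 ≤ I.radical)
    (h : ∀ I' : Ideal R, 𝔞 ≤ I'.radical → ∀ e : Abelian.Ext (ModuleCat.of R (R ⧸ I')) M i,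
      ∃ (K : Ideal R) (hK : K ≤ I) (hK' : K ≤ I')
        (e' : Abelian.Ext (ModuleCat.of R (R ⧸ I)) M i),
        𝔞 ≤ K.radical ∧ extQuotRes hK M i e' = extQuotRes hK' M i e) :
    Module.Finite R ((localCohomology 𝔞 i).obj M) := by
  obtain ⟨t, ht⟩ := exists_pow_le_of_le_radical hI
  refine Module.Finite.of_surjective (extToLocalCohomology 𝔞 M i t) fun x ↦ ?_
  obtain ⟨s, e, rfl⟩ := exists_extToLocalCohomology_eq x
  obtain ⟨K, hK, hK', e', hKr, he⟩ := h _ (le_radical_pow 𝔞 s) e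
  refine ⟨extQuotRes ht M i e', extToLocalCohomology_eq_of_extQuotRes_eq
    (le_radical_inf hKr (le_radical_pow 𝔞 t)) inf_le_right (inf_le_left.trans hK') ?_⟩
  rw [extQuotRes_extQuotRes, ← extQuotRes_extQuotRes inf_le_left hK, he, extQuotRes_extQuotRes]

variable [IsLocalRing R]

theorem extQuotTorsion_maximalIdeal_of_isArtinian
    [IsArtinian R ((localCohomology 𝔞 i).obj M)] :
    ExtQuotTorsion 𝔞 (IsLocalRing.maximalIdeal R) M i := by
  intro y hy I hI e
  obtain ⟨t, ht⟩ := exists_pow_le_of_le_radical hI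
  obtain ⟨k, hk⟩ := exists_pow_smul_eq_zero_of_isArtinian hy
    (extToLocalCohomology 𝔞 M i t (extQuotRes ht M i e))
  refine ⟨k, ExtQuotVanishes.of_extQuotRes (h := ht) ?_⟩
  rw [map_smul]
  exact extQuotVanishes_of_extToLocalCohomology_eq_zero (by rw [map_smul, hk])

end LocalCohomology

theorem filter_depth_le_finiteness_dim
    {R : Type u} [CommRing R] [IsNoetherianRing R] [IsLocalRing R]
    (𝔞 : Ideal R) (M : Type u) [AddCommGroup M] [Module R M] [Module.Finite R M] (r : ℕ)
    (h_not_fg : ¬ Module.Finite R ((localCohomology 𝔞 r).obj (ModuleCat.of R M)))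
    (h_fg : ∀ i < r, Module.Finite R ((localCohomology 𝔞 i).obj (ModuleCat.of R M)))
    (h_lt : ∀ i ≤ r,
      𝔞 ≤ (Module.annihilator R
        ((localCohomology (IsLocalRing.maximalIdeal R) i).obj (ModuleCat.of R M))).radical) :
    ∃ i ≤ r, ¬ IsArtinian R ((localCohomology 𝔞 i).obj (ModuleCat.of R M)) := by
  by_contra! hA
  refine h_not_fg ?_
  rcases eq_or_ne 𝔞 ⊤ with rfl | h𝔞
  · have : ∀ x : (localCohomology (⊤ : Ideal R) r).obj (ModuleCat.of R M), x = 0 := by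
      intro x
      obtain ⟨t, e, rfl⟩ := exists_extToLocalCohomology_eq x
      rw [← one_smul R e, smul_ext_eq_zero_of_mem e (by simp [Ideal.top_pow]), map_zero]
    have : Subsingleton ((localCohomology (⊤ : Ideal R) r).obj (ModuleCat.of R M)) :=
      subsingleton_of_forall_eq 0 this
    infer_instance
  have h𝔪 : 𝔞 ≤ IsLocalRing.maximalIdeal R := IsLocalRing.le_maximalIdeal h𝔞
  have hT : ∀ i ≤ r, ExtQuotTorsion 𝔞 (IsLocalRing.maximalIdeal R) (ModuleCat.of R M) i :=
    fun i hi ↦ have := hA i hi; extQuotTorsion_maximalIdeal_of_isArtinian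
  have hU : ∀ i ≤ r, ExtQuotUniformTorsion 𝔞 (ModuleCat.of R M) i := by
    intro i hi y hy
    obtain ⟨k, hk⟩ := h_lt i hi hy
    refine ⟨k, fun I hI e ↦ ?_⟩
    obtain ⟨L, K, hKI, hKL, e', hL, hK, he⟩ := exists_extQuotRes_eq_of_extQuotTorsion h𝔪 i
      (ModuleCat.of R M) (fun j hj ↦ hT j (hj.trans hi)) hI e
    refine ExtQuotVanishes.of_extQuotRes (h := hKI) ?_
    rw [map_smul, ← he, ← map_smul]
    refine ExtQuotVanishes.extQuotRes ?_ hKL hK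
    obtain ⟨J, hJ, hJ', h0⟩ := extQuotVanishes_smul_of_forall hL e' fun t ht ↦
      Module.mem_annihilator.1 hk _
    exact ⟨J, hJ, h𝔪.trans hJ', h0⟩
  obtain ⟨I, hI, h⟩ := exists_forall_extQuotRes_eq_of_extQuotUniformTorsion r _ hU
  exact finite_localCohomology hI h
end
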